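/- arXiv:1902.10765 — 3 statements merged into one kernel-verified Lean document; each statement's English description precedes it below -/
import Mathlib

section
/- Let G be a finite simple connected graph, Π a k-district map of G, and suppose a district V_ℓ ∈ Π contains the full vertex sets of two distinct leaf blocks w_i and w_j of G. Then no switch operation applied to Π can move any vertex of w_i ∪ w_j to another district; consequently, the district V_ℓ is incontractible. -/
open SimpleGraph

universe u

/-- A vertex `v` is a cut vertex of `G` if its removal disconnects `G`. -/
def IsCutVertex {V : Type u} (G : SimpleGraph V) (v : V) : Prop :=
  ¬ (G.induce ({v}ᶜ : Set V)).Connected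

/-- `G` is biconnected: it is connected and either consists of a single edge or has at
least three vertices and remains connected after the deletion of any single vertex. -/
def Biconnected {V : Type u} (G : SimpleGraph V) : Prop :=
  G.Connected ∧
  ((∃ a b : V, a ≠ b ∧ G.Adj a b ∧ (Set.univ : Set V) = {a, b}) ∨
   (3 ≤ Nat.card V ∧ ∀ v : V, (G.induce ({v}ᶜ : Set V)).Connected))

/-- A set of vertices inducing a biconnected subgraph of `G`. -/
def IsBiconnectedSet {V : Type u} (G : SimpleGraph V) (s : Set V) : Prop :=
  (G.induce s).Connected ∧
  ((∃ a b : V, a ≠ b ∧ G.Adj a b ∧ s = {a, b}) ∨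
   (3 ≤ s.ncard ∧ ∀ v ∈ s, (G.induce (s \ {v})).Connected))

/-- A block of `G`: the vertex set of a maximal biconnected subgraph. -/
def IsBlock {V : Type u} (G : SimpleGraph V) (s : Set V) : Prop :=
  IsBiconnectedSet G s ∧ ∀ t : Set V, IsBiconnectedSet G t → s ⊆ t → t = s

/-- A leaf block of `G`: a block that is a leaf of the block tree, i.e. a block
containing at most one cut vertex of `G`. -/
def IsLeafBlock {V : Type u} (G : SimpleGraph V) (s : Set V) : Prop :=
  IsBlock G s ∧ ({v ∈ s | IsCutVertex G v}).ncard ≤ 1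

/-- A `k`-district map of `G`: a partition of the vertex set of `G` into `k` nonempty
subsets (districts), each of which induces a connected subgraph of `G`. -/
structure DistrictMap {V : Type u} (G : SimpleGraph V) (k : ℕ) where
  parts : Set (Set V)
  ncard_parts : parts.ncard = k
  nonempty_mem : ∀ s ∈ parts, s.Nonempty
  pairwise_disjoint : parts.Pairwise Disjoint
  covers : ∀ v : V, ∃ s ∈ parts, v ∈ s
  connected_mem : ∀ s ∈ parts, (G.induce s).Connected

section SwitchDefs

variable {V : Type u} {G : SimpleGraph V} {k : ℕ}

/-- The switch operation `switch_P(u,v,w)` is defined: `(u,v,w)` is a path of `G`,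
`P(u) = P(v) ≠ P(w)`, and `P(v) \ {v}` is nonempty and induces a connected subgraph. -/
def SwitchDefined (P : DistrictMap G k) (u v w : V) : Prop :=
  ∃ su sw : Set V,
    G.Adj u v ∧ G.Adj v w ∧
    su ∈ P.parts ∧ sw ∈ P.parts ∧ u ∈ su ∧ v ∈ su ∧ w ∈ sw ∧ su ≠ sw ∧
    (su \ {v} : Set V).Nonempty ∧ (G.induce (su \ {v})).Connected

/-- `Q = switch_P(u,v,w)`: the district map obtained from `P` by moving `v`
from `P(v)` to `P(w)`. -/
def SwitchedAt (P Q : DistrictMap G k) (u v w : V) : Prop :=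
  ∃ su sw : Set V,
    G.Adj u v ∧ G.Adj v w ∧
    su ∈ P.parts ∧ sw ∈ P.parts ∧ u ∈ su ∧ v ∈ su ∧ w ∈ sw ∧ su ≠ sw ∧
    (su \ {v} : Set V).Nonempty ∧ (G.induce (su \ {v})).Connected ∧
    Q.parts = (P.parts \ {su, sw}) ∪ {su \ {v}, insert v sw}

/-- `Q` is obtained from `P` by a single switch. -/
def Switch (P Q : DistrictMap G k) : Prop := ∃ u v w : V, SwitchedAt P Q u v w

/-- Adjacency in the switch graph `Γ_k(G)`. -/
def SwitchAdj (P Q : DistrictMap G k) : Prop := Switch P Q ∨ Switch Q P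

/-- `f 0, f 1, …, f m` is a walk in the switch graph `Γ_k(G)`. -/
def SwitchChain (f : ℕ → DistrictMap G k) (m : ℕ) : Prop :=
  ∀ i < m, SwitchAdj (f i) (f (i + 1))

/-- A single switch taking `P` to `Q` that contracts the district `s` to `s' = s \ {v}`. -/
def SwitchOut (P Q : DistrictMap G k) (s s' : Set V) : Prop :=
  ∃ u v w : V, ∃ sw : Set V,
    G.Adj u v ∧ G.Adj v w ∧
    s ∈ P.parts ∧ sw ∈ P.parts ∧ u ∈ s ∧ v ∈ s ∧ w ∈ sw ∧ s ≠ sw ∧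
    s' = s \ {v} ∧ s'.Nonempty ∧ (G.induce s').Connected ∧
    Q.parts = (P.parts \ {s, sw}) ∪ {s', insert v sw}

/-- District `s` of `P` can be contracted to the singleton `{t}` by a sequence
of `|s| - 1` switches. -/
def ContractibleTo (P : DistrictMap G k) (s : Set V) (t : V) : Prop :=
  s ∈ P.parts ∧
  ∃ (f : ℕ → DistrictMap G k) (g : ℕ → Set V),
    f 0 = P ∧ g 0 = s ∧ g (s.ncard - 1) = {t} ∧
    ∀ i < s.ncard - 1, SwitchOut (f i) (f (i + 1)) (g i) (g (i + 1))

/-- District `s` of `P` is contractible. -/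
def ContractibleDistrict (P : DistrictMap G k) (s : Set V) : Prop :=
  ∃ t : V, ContractibleTo P s t

/-- A district map is contractible if all of its districts are contractible. -/
def ContractibleMap (P : DistrictMap G k) : Prop :=
  ∀ s ∈ P.parts, ContractibleDistrict P s

end SwitchDefs

/-- A diamond in `G`: an induced subgraph determined by two cut vertices `v₁, v₂` of `G`
connected by `m ≥ 2` internally disjoint paths, of which at least `m - 1` have exactly one
interior vertex, together with dangling paths from `v₁` and `v₂` to leaves `u₁` and `u₂`. -/
structure Diamond {V : Type u} (G : SimpleGraph V) where
  v₁ : V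
  v₂ : V
  u₁ : V
  u₂ : V
  m : ℕ
  two_le_m : 2 ≤ m
  ne_v : v₁ ≠ v₂
  path : Fin m → G.Walk v₁ v₂
  path_isPath : ∀ i, (path i).IsPath
  internally_disjoint : ∀ i j, i ≠ j →
    {x | x ∈ (path i).support} ∩ {x | x ∈ (path j).support} = {v₁, v₂}
  short : ({i | (path i).length ≠ 2} : Set (Fin m)).ncard ≤ 1
  cut₁ : IsCutVertex G v₁
  cut₂ : IsCutVertex G v₂
  dang₁ : G.Walk v₁ u₁
  dang₂ : G.Walk v₂ u₂
  dang₁_isPath : dang₁.IsPath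
  dang₂_isPath : dang₂.IsPath
  leaf₁ : (G.neighborSet u₁).ncard = 1
  leaf₂ : (G.neighborSet u₂).ncard = 1
  dang₁_disjoint : ∀ i, {x | x ∈ dang₁.support} ∩ {x | x ∈ (path i).support} = {v₁}
  dang₂_disjoint : ∀ i, {x | x ∈ dang₂.support} ∩ {x | x ∈ (path i).support} = {v₂}
  dang_disjoint : {x | x ∈ dang₁.support} ∩ {x | x ∈ dang₂.support} = ∅
  induced : ∀ x y : V,
    x ∈ ({x | ∃ i, x ∈ (path i).support} ∪ {x | x ∈ dang₁.support} ∪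
          {x | x ∈ dang₂.support} : Set V) →
    y ∈ ({x | ∃ i, x ∈ (path i).support} ∪ {x | x ∈ dang₁.support} ∪
          {x | x ∈ dang₂.support} : Set V) →
    G.Adj x y →
    (∃ i, s(x, y) ∈ (path i).edges) ∨ s(x, y) ∈ dang₁.edges ∨ s(x, y) ∈ dang₂.edges

/-- A diamond chain of length `r` in `G`: `r` diamonds `A₁, …, A_r`, where diamond `Aᵢ`
has cut vertices `v₁ i`, `v₂ i`, left path through `a i` and right path through `a (i+1)`
(each with exactly one interior vertex), the interior vertex of the right path of `Aᵢ`
being identified with the interior vertex of the left path of `Aᵢ₊₁`, and leaves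
`u₁ i`, `u₂ i` attached by single edges to the cut vertices; the `5r + 1` vertices are
pairwise distinct and each diamond is an induced subgraph of `G`. -/
structure DiamondChain {V : Type u} (G : SimpleGraph V) (r : ℕ) where
  v₁ : Fin r → V
  v₂ : Fin r → V
  a : Fin (r + 1) → V
  u₁ : Fin r → V
  u₂ : Fin r → V
  adj₁ : ∀ i : Fin r, G.Adj (v₁ i) (a i.castSucc)
  adj₂ : ∀ i : Fin r, G.Adj (a i.castSucc) (v₂ i)
  adj₃ : ∀ i : Fin r, G.Adj (v₁ i) (a i.succ)
  adj₄ : ∀ i : Fin r, G.Adj (a i.succ) (v₂ i)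
  adj_u₁ : ∀ i : Fin r, G.Adj (v₁ i) (u₁ i)
  adj_u₂ : ∀ i : Fin r, G.Adj (v₂ i) (u₂ i)
  leaf₁ : ∀ i : Fin r, (G.neighborSet (u₁ i)).ncard = 1
  leaf₂ : ∀ i : Fin r, (G.neighborSet (u₂ i)).ncard = 1
  cut₁ : ∀ i : Fin r, IsCutVertex G (v₁ i)
  cut₂ : ∀ i : Fin r, IsCutVertex G (v₂ i)
  card_support :
    ({x | (∃ i, x = v₁ i) ∨ (∃ i, x = v₂ i) ∨ (∃ i, x = a i) ∨ (∃ i, x = u₁ i) ∨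
      (∃ i, x = u₂ i)} : Set V).ncard = 5 * r + 1
  induced : ∀ i : Fin r, ∀ x y : V,
    x ∈ ({v₁ i, v₂ i, a i.castSucc, a i.succ, u₁ i, u₂ i} : Set V) →
    y ∈ ({v₁ i, v₂ i, a i.castSucc, a i.succ, u₁ i, u₂ i} : Set V) →
    G.Adj x y →
    s(x, y) ∈ ({s(v₁ i, a i.castSucc), s(a i.castSucc, v₂ i), s(v₁ i, a i.succ),
      s(a i.succ, v₂ i), s(v₁ i, u₁ i), s(v₂ i, u₂ i)} : Set (Sym2 V))

/-- The vertex set of a diamond chain. -/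
def DiamondChain.support {V : Type u} {G : SimpleGraph V} {r : ℕ}
    (C : DiamondChain G r) : Set V :=
  {x | (∃ i, x = C.v₁ i) ∨ (∃ i, x = C.v₂ i) ∨ (∃ i, x = C.a i) ∨ (∃ i, x = C.u₁ i) ∨
    (∃ i, x = C.u₂ i)}

section BlockLemmas

variable {V : Type u} {G : SimpleGraph V}

lemma IsBiconnectedSet.connected_diff_singleton {s : Set V} (hs : IsBiconnectedSet G s) (x : V) :
    (G.induce (s \ {x})).Connected := by
  by_cases hx : x ∈ s
  · rcases hs.2 with ⟨a, b, hab, -, rfl⟩ | h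
    · have key : ∃ c, ({a, b} : Set V) \ {x} = {c} := by
        rcases hx with rfl | rfl
        · exact ⟨b, by ext y; simp; grind⟩
        · exact ⟨a, by ext y; simp; grind⟩
      obtain ⟨c, hc⟩ := key
      rw [hc, induce_singleton_eq_top]
      exact connected_top
    · exact h.2 x hx
  · rw [Set.sdiff_singleton_eq_self hx]
    exact hs.1

lemma IsBiconnectedSet.two_le_ncard {s : Set V} (hs : IsBiconnectedSet G s) : 2 ≤ s.ncard := by
  rcases hs.2 with ⟨a, b, hab, -, rfl⟩ | h
  · exact (Set.ncard_pair hab).ge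
  · omega

lemma SimpleGraph.Walk.IsPath.eq_of_mem_takeUntil_of_mem_dropUntil [DecidableEq V] {a b x y : V}
    {p : G.Walk a b} (hp : p.IsPath) (hy : y ∈ p.support)
    (h₁ : x ∈ (p.takeUntil y hy).support) (h₂ : x ∈ (p.dropUntil y hy).support) : x = y := by
  by_contra hxy
  have hnd := hp.support_nodup
  rw [← p.take_spec hy, Walk.support_append, List.nodup_append'] at hnd
  exact hnd.2.2 h₁ (((Walk.mem_support_iff _).mp h₂).resolve_left hxy)

/-- Adding an ear to a biconnected set keeps it biconnected. -/
lemma IsBiconnectedSet.union_path [Finite V] {s : Set V} (hs : IsBiconnectedSet G s)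
    {v w z : V} (hv : v ∈ s) (hw : w ∉ s) (hz : z ∈ s) (hvw : G.Adj v w) {p : G.Walk w z}
    (hp : p.IsPath) (hvp : v ∉ p.support) :
    IsBiconnectedSet G (s ∪ {y | y ∈ p.support}) := by
  classical
  refine ⟨induce_union_connected hs.1.preconnected p.connected_induce_support.preconnected
    ⟨z, hz, p.end_mem_support⟩, Or.inr ⟨?_, fun x _ => ?_⟩⟩
  · calc 3 ≤ s.ncard + 1 := by have := hs.two_le_ncard; omega
      _ = (insert w s).ncard := (Set.ncard_insert_of_notMem hw).symm
      _ ≤ _ := Set.ncard_le_ncard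
        (Set.insert_subset (Or.inr p.start_mem_support) Set.subset_union_left)
  · have hsx := hs.connected_diff_singleton x
    obtain ⟨b, hb⟩ := hsx.nonempty
    refine induce_connected_of_patches b ⟨Or.inl hb.1, hb.2⟩ ?_
    rintro y ⟨hy | hy, hyx⟩
    · exact ⟨s \ {x}, Set.sdiff_subset_sdiff_left Set.subset_union_left, hb, ⟨hy, hyx⟩,
        hsx.preconnected _ _⟩
    · by_cases hxt : x ≠ v ∧ x ∉ (p.takeUntil y hy).support
      · refine ⟨s \ {x} ∪ {a | a ∈ (p.takeUntil y hy).support}, ?_, Or.inl hb,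
          Or.inr (Walk.end_mem_support _),
          (connected_induce_union hsx.preconnected
            (Walk.connected_induce_support _).preconnected ⟨hv, hxt.1.symm⟩
            (Walk.start_mem_support _) hvw).preconnected _ _⟩
        rintro a (ha | ha)
        · exact ⟨Or.inl ha.1, ha.2⟩
        · exact ⟨Or.inr (p.support_takeUntil_subset_support hy ha), fun h => hxt.2 (h ▸ ha)⟩
      · have hxd : x ∉ (p.dropUntil y hy).support := by
          intro hxd
          apply hxt
          refine ⟨?_, fun h => hyx (hp.eq_of_mem_takeUntil_of_mem_dropUntil hy h hxd).symm⟩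
          rintro rfl
          exact hvp (p.support_dropUntil_subset_support hy hxd)
        refine ⟨s \ {x} ∪ {a | a ∈ (p.dropUntil y hy).support}, ?_, Or.inl hb,
          Or.inr (Walk.start_mem_support _),
          (induce_union_connected hsx.preconnected
            (Walk.connected_induce_support _).preconnected
            ⟨z, ⟨hz, ?_⟩, Walk.end_mem_support _⟩).preconnected _ _⟩
        · rintro a (ha | ha)
          · exact ⟨Or.inl ha.1, ha.2⟩
          · exact ⟨Or.inr (p.support_dropUntil_subset_support hy ha), fun h => hxd (h ▸ ha)⟩
        · rintro rfl
          exact hxd (Walk.end_mem_support _)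

/-- A block contains all neighbours of those of its vertices which are not cut vertices. -/
lemma IsBlock.mem_of_adj [Finite V] {s : Set V} (hs : IsBlock G s) {v w : V} (hv : v ∈ s)
    (hcut : ¬ IsCutVertex G v) (hvw : G.Adj v w) : w ∈ s := by
  classical
  by_contra hw
  obtain ⟨z, hz, hzv⟩ := (hs.1.connected_diff_singleton v).nonempty
  obtain ⟨q⟩ := (not_not.mp hcut).preconnected ⟨w, hvw.ne'⟩ ⟨z, hzv⟩
  let p : G.Walk w z := q.map (Embedding.induce _).toHom
  have hvp : v ∉ p.support := by
    intro h
    obtain ⟨⟨a, ha⟩, -, hav⟩ := List.mem_map.mp ((Walk.support_map _ q) ▸ h)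
    exact ha hav
  have hvb : v ∉ p.bypass.support := fun h => hvp (p.support_bypass_subset_support h)
  have hT := hs.1.union_path hv hw hz hvw p.bypass_isPath hvb
  have heq := hs.2 _ hT Set.subset_union_left
  exact hw (heq ▸ Or.inr p.bypass.start_mem_support)

lemma IsLeafBlock.not_isCutVertex [Finite V] {s : Set V} (hs : IsLeafBlock G s) {v y : V}
    (hv : v ∈ s) (hcut : IsCutVertex G v) (hy : y ∈ s) (hyv : y ≠ v) : ¬ IsCutVertex G y :=
  fun h => hyv ((Set.ncard_le_one).mp hs.2 y ⟨hy, h⟩ v ⟨hv, hcut⟩)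

/-- A connected induced subgraph that meets a set closed under adjacency within the subgraph
lies inside that set. -/
lemma subset_of_connected_induce_of_adj {s t : Set V} (ht : (G.induce t).Connected)
    {a : V} (ha : a ∈ t) (has : a ∈ s) (h : ∀ x ∈ s, ∀ y ∈ t, G.Adj x y → y ∈ s) : t ⊆ s := by
  intro y hy
  obtain ⟨p⟩ := ht.preconnected ⟨a, ha⟩ ⟨y, hy⟩
  have key : ∀ {c d : t} (_ : (G.induce t).Walk c d), c.1 ∈ s → d.1 ∈ s := by
    intro c d p
    induction p with
    | nil => exact id
    | cons hadj _ ih => exact fun hc => ih (h _ hc _ (Subtype.prop _) hadj)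
  exact key p has

lemma IsLeafBlock.subset_of_connected_diff [Finite V] {s t : Set V} (hs : IsLeafBlock G s)
    (hst : s ⊆ t) {v : V} (hv : v ∈ s) (hcut : IsCutVertex G v)
    (ht : (G.induce (t \ {v})).Connected) : t ⊆ s := by
  obtain ⟨a, ha, hav⟩ := (hs.1.1.connected_diff_singleton v).nonempty
  have hsub : t \ {v} ⊆ s \ {v} := by
    refine subset_of_connected_induce_of_adj ht ⟨hst ha, hav⟩ ⟨ha, hav⟩ ?_
    rintro x ⟨hx, hxv⟩ y ⟨-, hyv⟩ hxy
    exact ⟨hs.1.mem_of_adj hx (hs.not_isCutVertex hv hcut hx hxv) hxy, hyv⟩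
  intro y hy
  by_cases hyv : y = v
  · exact hyv ▸ hv
  · exact (hsub ⟨hy, hyv⟩).1

end BlockLemmas

section Districts

variable {V : Type u} {G : SimpleGraph V} {k : ℕ}

lemma DistrictMap.eq_of_mem (P : DistrictMap G k) {s t : Set V} (hs : s ∈ P.parts)
    (ht : t ∈ P.parts) {x : V} (hxs : x ∈ s) (hxt : x ∈ t) : s = t := by
  by_contra h
  exact Set.disjoint_left.mp (P.pairwise_disjoint hs ht h) hxs hxt

/-- No vertex of a leaf block can be switched out of a district which contains that leaf block
and another block. -/
lemma not_switchDefined_of_isLeafBlock [Finite V] {P : DistrictMap G k} {D s t : Set V}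
    (hD : D ∈ P.parts) (hs : IsLeafBlock G s) (ht : IsBlock G t) (hne : s ≠ t)
    (hsD : s ⊆ D) (htD : t ⊆ D) {u x w : V} (hx : x ∈ s) : ¬ SwitchDefined P u x w := by
  rintro ⟨su, sw, -, hxw, hsu, hsw, -, hxsu, hwsw, hsne, -, hconn⟩
  obtain rfl := P.eq_of_mem hD hsu (hsD hx) hxsu
  by_cases hcut : IsCutVertex G x
  · exact hne (ht.2 s hs.1.1 (htD.trans (hs.subset_of_connected_diff hsD hx hcut hconn)))
  · exact hsne (P.eq_of_mem hD hsw (hsD (hs.1.mem_of_adj hx hcut hxw)) hwsw)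

lemma not_switchDefined_of_two_leaf_blocks [Finite V] {P : DistrictMap G k} {D s t : Set V}
    (hD : D ∈ P.parts) (hs : IsLeafBlock G s) (ht : IsLeafBlock G t) (hne : s ≠ t)
    (hsD : s ⊆ D) (htD : t ⊆ D) {u x w : V} (hx : x ∈ s ∪ t) : ¬ SwitchDefined P u x w := by
  rcases hx with hx | hx
  · exact not_switchDefined_of_isLeafBlock hD hs ht.1 hne hsD htD hx
  · exact not_switchDefined_of_isLeafBlock hD ht hs.1 hne.symm htD hsD hx

lemma SwitchOut.union_subset_of_two_leaf_blocks [Finite V] {P Q : DistrictMap G k}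
    {D D' s t : Set V} (h : SwitchOut P Q D D') (hs : IsLeafBlock G s) (ht : IsLeafBlock G t)
    (hne : s ≠ t) (hsub : s ∪ t ⊆ D) : s ∪ t ⊆ D' := by
  obtain ⟨u, v, w, sw, huv, hvw, hD, hsw, hu, hv, hw, hDsw, rfl, hnonempty, hconn, -⟩ := h
  intro x hx
  refine ⟨hsub hx, ?_⟩
  rintro rfl
  exact not_switchDefined_of_two_leaf_blocks hD hs ht hne (Set.subset_union_left.trans hsub)
    (Set.subset_union_right.trans hsub) hx
    ⟨D, sw, huv, hvw, hD, hsw, hu, hv, hw, hDsw, hnonempty, hconn⟩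

end Districts

/-- If a district contains two distinct leaf blocks, then no switch can move
any vertex of their union to another district; consequently, the district is incontractible. -/
theorem two_leaf_blocks_incontractible {V : Type u} [Fintype V] (G : SimpleGraph V)
    (hG : G.Connected) (k : ℕ) (P : DistrictMap G k) (Vl wi wj : Set V)
    (hVl : Vl ∈ P.parts)
    (hwi : IsLeafBlock G wi) (hwj : IsLeafBlock G wj) (hne : wi ≠ wj)
    (hiw : wi ⊆ Vl) (hjw : wj ⊆ Vl) :
    (∀ u x w : V, x ∈ wi ∪ wj → ¬ SwitchDefined P u x w) ∧
    ¬ ContractibleDistrict P Vl := by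
  refine ⟨fun u x w hx => not_switchDefined_of_two_leaf_blocks hVl hwi hwj hne hiw hjw hx, ?_⟩
  rintro ⟨t, -, f, g, -, hg0, hgt, hstep⟩
  have hsub : ∀ i ≤ Vl.ncard - 1, wi ∪ wj ⊆ g i := by
    intro i
    induction i with
    | zero => exact fun _ => hg0 ▸ Set.union_subset hiw hjw
    | succ i ih =>
      exact fun hi => (hstep i hi).union_subset_of_two_leaf_blocks hwi hwj hne
        (ih (Nat.le_of_succ_le hi))
  have hle : wi ⊆ {t} := hgt ▸ Set.subset_union_left.trans (hsub _ le_rfl)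
  have hcard := Set.ncard_le_ncard hle
  rw [Set.ncard_singleton] at hcard
  have := hwi.1.1.two_le_ncard
  omega
end

section
/- There exists an absolute constant C > 0 such that for every biconnected graph G with n vertices and every k ∈ ℕ with 1 ≤ k ≤ n, the switch graph Γ_k(G) is connected and its diameter is at most C·k·n. -/
open SimpleGraph

universe u

section ConnectedSets

variable {V : Type*} {G : SimpleGraph V} {S U : Set V} {t v w x : V}

/-- `U` is closed under taking neighbours inside `S`. -/
def ClosedIn (G : SimpleGraph V) (S U : Set V) : Prop :=
  ∀ a ∈ U, ∀ b ∈ S, G.Adj a b → b ∈ U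

/-- `S` is nonempty and induces a connected subgraph, phrased through cuts. -/
def ConnectedOn (G : SimpleGraph V) (S : Set V) : Prop :=
  S.Nonempty ∧ ∀ U ⊆ S, U.Nonempty → ClosedIn G S U → U = S

/-- The vertices that can be reached from `t` by walks that stay in `S` after `t`. -/
def componentIn (G : SimpleGraph V) (S : Set V) (t : V) : Set V :=
  {y | Relation.ReflTransGen (fun a b => G.Adj a b ∧ b ∈ S) t y}

theorem mem_componentIn_self : t ∈ componentIn G S t := Relation.ReflTransGen.refl

theorem closedIn_componentIn : ClosedIn G S (componentIn G S t) :=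
  fun _ ha _ hb hab => Relation.ReflTransGen.tail ha ⟨hab, hb⟩

theorem componentIn_subset_of_closedIn (ht : t ∈ U) (hU : ClosedIn G S U) :
    componentIn G S t ⊆ U := by
  intro y hy
  induction hy with
  | refl => exact ht
  | tail _ h ih => exact hU _ ih _ h.2 h.1

theorem componentIn_subset (ht : t ∈ S) : componentIn G S t ⊆ S :=
  componentIn_subset_of_closedIn ht fun _ _ _ hb _ => hb

theorem connectedOn_componentIn : ConnectedOn G (componentIn G S t) := by
  refine ⟨⟨t, mem_componentIn_self⟩, fun U hUC hU hcl => ?_⟩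
  by_cases htU : t ∈ U
  · refine hUC.antisymm (componentIn_subset_of_closedIn htU fun a ha b hb hab => ?_)
    exact hcl a ha b (closedIn_componentIn a (hUC ha) b hb hab) hab
  · obtain ⟨u, hu⟩ := hU
    have h : componentIn G S t ⊆ componentIn G S t \ U := by
      refine componentIn_subset_of_closedIn ⟨mem_componentIn_self, htU⟩ ?_
      intro a ha b hb hab
      exact ⟨closedIn_componentIn a ha.1 b hb hab, fun hbU => ha.2 (hcl b hbU a ha.1 hab.symm)⟩
    exact absurd hu (h (hUC hu)).2

theorem connectedOn_iff : ConnectedOn G S ↔ (G.induce S).Connected := by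
  constructor
  · rintro ⟨⟨t, ht⟩, h⟩
    rw [connected_iff_exists_forall_reachable]
    refine ⟨⟨t, ht⟩, fun y => ?_⟩
    have key := h {z | ∃ hz : z ∈ S, (G.induce S).Reachable ⟨t, ht⟩ ⟨z, hz⟩}
      (fun z hz => hz.1) ⟨t, ht, Reachable.refl _⟩ ?_
    · have hy : (y : V) ∈ {z | ∃ hz : z ∈ S, (G.induce S).Reachable ⟨t, ht⟩ ⟨z, hz⟩} :=
        key.symm ▸ y.2
      exact hy.2
    · rintro a ⟨ha, hr⟩ b hb hab
      exact ⟨hb, hr.trans (Adj.reachable (by simpa using hab))⟩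
  · intro h
    obtain ⟨t⟩ := h.nonempty
    refine ⟨⟨t, t.2⟩, fun U hUS hU hcl => hUS.antisymm fun y hy => ?_⟩
    obtain ⟨u, hu⟩ := hU
    obtain ⟨p⟩ := h.preconnected ⟨u, hUS hu⟩ ⟨y, hy⟩
    have aux : ∀ a b : S, (G.induce S).Walk a b → (a : V) ∈ U → (b : V) ∈ U := by
      intro a b p
      induction p with
      | nil => exact id
      | cons hab _ ih => exact fun ha => ih (hcl _ ha _ (Subtype.prop _) (by simpa using hab))
    exact aux _ _ p hu

theorem connectedOn_singleton (v : V) : ConnectedOn G {v} :=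
  ⟨⟨v, rfl⟩, fun _ hUS hU _ => hU.subset_singleton_iff.mp hUS⟩

theorem ConnectedOn.insert_of_adj (hS : ConnectedOn G S) (hw : w ∈ S) (hvw : G.Adj v w) :
    ConnectedOn G (insert v S) := by
  refine ⟨⟨v, Set.mem_insert _ _⟩, fun U hUS hU hcl => hUS.antisymm ?_⟩
  have hUS' : U ∩ S = S := by
    refine hS.2 _ Set.inter_subset_right ?_ fun a ha b hb hab =>
      ⟨hcl a ha.1 b (Set.mem_insert_of_mem _ hb) hab, hb⟩
    obtain ⟨u, hu⟩ := hU
    rcases hUS hu with rfl | huS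
    · exact ⟨w, hcl _ hu w (Set.mem_insert_of_mem _ hw) hvw, hw⟩
    · exact ⟨u, hu, huS⟩
  have hSU : S ⊆ U := Set.inter_eq_right.mp hUS'
  exact Set.insert_subset (hcl w (hSU hw) v (Set.mem_insert _ _) hvw.symm) hSU

theorem ConnectedOn.exists_adj (hS : ConnectedOn G S) (hUS : U ⊆ S) (hU : U.Nonempty)
    (hne : (S \ U).Nonempty) : ∃ a ∈ U, ∃ b ∈ S, b ∉ U ∧ G.Adj a b := by
  by_contra! h
  have := hS.2 U hUS hU fun a ha b hb hab => by_contra fun hbU => h a ha b hb hbU hab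
  simp [this] at hne

theorem ConnectedOn.exists_diff_singleton [Finite V] (hS : ConnectedOn G S)
    (hcard : 1 < S.ncard) : ∃ t ∈ S, ConnectedOn G (S \ {t}) := by
  obtain ⟨r, hr⟩ := hS.1
  have hrS : ({r} : Set V) ⊂ S := by
    refine ⟨Set.singleton_subset_iff.mpr hr, fun h => ?_⟩
    have := Set.ncard_le_ncard h
    rw [Set.ncard_singleton] at this
    omega
  obtain ⟨T, ⟨hT, hTS⟩, hmax⟩ := (Set.toFinite {T : Set V | ConnectedOn G T ∧ T ⊂ S}).exists_maximal
    ⟨{r}, connectedOn_singleton r, hrS⟩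
  obtain ⟨a, ha, b, hb, hbT, hab⟩ :=
    hS.exists_adj hTS.subset hT.1 (Set.nonempty_of_ssubset hTS)
  have hins : ConnectedOn G (insert b T) := hT.insert_of_adj ha hab.symm
  have hsub : insert b T ⊆ S := Set.insert_subset hb hTS.subset
  have heq : insert b T = S := by
    by_contra hne
    exact hbT (hmax ⟨hins, hsub.ssubset_of_ne hne⟩ (Set.subset_insert b T) (Set.mem_insert b T))
  refine ⟨b, hb, ?_⟩
  rwa [← heq, Set.insert_sdiff_self_of_notMem hbT]

/-- If removing `x` from a connected set `S` cuts some vertices off from `t`, then one of these is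
adjacent to the outside of `S` and can be removed while keeping `S` connected. -/
theorem exists_removable_of_cut_off [Finite V] (hG : ∀ c, ConnectedOn G ({c}ᶜ : Set V))
    (hS : ConnectedOn G S) (hSV : S ≠ Set.univ) (ht : t ∈ S) (hx : x ∈ S) (hxt : x ≠ t)
    (hD : ((S \ {x}) \ componentIn G (S \ {x}) t).Nonempty) :
    ∃ v ∈ (S \ {x}) \ componentIn G (S \ {x}) t,
      ConnectedOn G (S \ {v}) ∧ ∃ w, w ∉ S ∧ G.Adj v w := by
  induction hn : ((S \ {x}) \ componentIn G (S \ {x}) t).ncard using Nat.strong_induction_on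
    generalizing x with
  | _ n ih =>
  obtain ⟨z, hz⟩ := (Set.ne_univ_iff_exists_notMem S).mp hSV
  obtain ⟨v, hv, w, hwx, hwD, hvw⟩ := (hG x).exists_adj
    (U := (S \ {x}) \ componentIn G (S \ {x}) t) (fun y hy => hy.1.2) hD
    ⟨z, fun h => hz (h ▸ hx), fun h => hz h.1.1⟩
  have hwS : w ∉ S := fun hwS => hwD ⟨⟨hwS, hwx⟩, fun hwC =>
    hv.2 (closedIn_componentIn w hwC v hv.1 hvw.symm)⟩
  have htv : t ≠ v := fun h => hv.2 (h ▸ mem_componentIn_self)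
  have htSv : t ∈ S \ {v} := ⟨ht, htv⟩
  have hC : componentIn G (S \ {x}) t ⊆ componentIn G (S \ {v}) t := by
    refine (componentIn_subset_of_closedIn (U := componentIn G (S \ {v}) t ∩
      componentIn G (S \ {x}) t) ⟨mem_componentIn_self, mem_componentIn_self⟩ ?_).trans
      Set.inter_subset_left
    intro a ha b hb hab
    have hbC := closedIn_componentIn a ha.2 b hb hab
    exact ⟨closedIn_componentIn a ha.1 b ⟨hb.1, fun h => hv.2 (h ▸ hbC)⟩ hab, hbC⟩
  have hxC : x ∈ componentIn G (S \ {v}) t := by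
    have hsub : componentIn G (S \ {x}) t ⊆ S \ {x} := componentIn_subset ⟨ht, hxt.symm⟩
    obtain ⟨a, ha, b, hb, hbC, hab⟩ := hS.exists_adj (hsub.trans Set.sdiff_subset)
      ⟨t, mem_componentIn_self⟩ ⟨x, hx, fun h => (hsub h).2 rfl⟩
    have hbx : b = x := by
      by_contra hbx
      exact hbC (closedIn_componentIn a ha b ⟨hb, hbx⟩ hab)
    subst hbx
    exact closedIn_componentIn a (hC ha) b ⟨hb, fun h => hv.1.2 h.symm⟩ hab
  rcases ((S \ {v}) \ componentIn G (S \ {v}) t).eq_empty_or_nonempty with hD' | hD'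
  · have : componentIn G (S \ {v}) t = S \ {v} :=
      (componentIn_subset htSv).antisymm (Set.sdiff_eq_empty.mp hD')
    exact ⟨v, hv, this ▸ connectedOn_componentIn, w, hwS, hvw⟩
  · have hsub : (S \ {v}) \ componentIn G (S \ {v}) t ⊆ (S \ {x}) \ componentIn G (S \ {x}) t :=
      fun y hy => ⟨⟨hy.1.1, fun h => hy.2 (h ▸ hxC)⟩, fun h => hy.2 (hC h)⟩
    obtain ⟨v', hv', h⟩ := ih _ (hn ▸ Set.ncard_lt_ncard ⟨hsub, fun h => (h hv).1.2 rfl⟩)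
      hv.1.1 htv.symm hD' rfl
    exact ⟨v', hsub hv', h⟩

end ConnectedSets

section Labelings

variable {V : Type*} {G : SimpleGraph V} {k : ℕ}

/-- A labelling of the vertices by `k` labels all of whose fibres are nonempty and connected. -/
def IsDistrictLabeling (G : SimpleGraph V) (f : V → Fin k) : Prop :=
  ∀ i, ConnectedOn G (f ⁻¹' {i})

theorem DistrictMap.ext_parts {P Q : DistrictMap G k} (h : P.parts = Q.parts) : P = Q := by
  cases P; cases Q; cases h; rfl

/-- The district map formed by the fibres of a labelling. -/
def IsDistrictLabeling.toMap {f : V → Fin k} (hf : IsDistrictLabeling G f) : DistrictMap G k where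
  parts := Set.range fun i => f ⁻¹' {i}
  ncard_parts := by
    rw [← Set.image_univ, Set.ncard_image_of_injective, Set.ncard_univ, Nat.card_fin]
    intro i j hij
    obtain ⟨a, ha⟩ := (hf i).1
    have ha' : a ∈ f ⁻¹' {j} := by rwa [← show f ⁻¹' {i} = f ⁻¹' {j} from hij]
    exact ha.symm.trans ha'
  nonempty_mem := by
    rintro _ ⟨i, rfl⟩
    exact (hf i).1
  pairwise_disjoint := by
    rintro _ ⟨i, rfl⟩ _ ⟨j, rfl⟩ hij
    refine Set.disjoint_left.mpr fun a hi hj => hij ?_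
    rw [show i = j from hi.symm.trans hj]
  covers v := ⟨_, ⟨f v, rfl⟩, rfl⟩
  connected_mem := by
    rintro _ ⟨i, rfl⟩
    exact connectedOn_iff.mp (hf i)

theorem DistrictMap.exists_labeling [Finite V] (P : DistrictMap G k) :
    ∃ (f : V → Fin k) (hf : IsDistrictLabeling G f), hf.toMap = P := by
  choose p hp hvp using P.covers
  have e : P.parts ≃ Fin k := Finite.equivFinOfCardEq P.ncard_parts
  have hfib : ∀ i, (fun v => e ⟨p v, hp v⟩) ⁻¹' {i} = (e.symm i : Set V) := by
    intro i
    ext v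
    simp only [Set.mem_preimage, Set.mem_singleton_iff, ← Equiv.eq_symm_apply]
    constructor
    · intro h
      rw [← h]
      exact hvp v
    · intro h
      refine Subtype.ext (by_contra fun hne => ?_)
      exact Set.disjoint_left.mp (P.pairwise_disjoint (hp v) (e.symm i).2 hne) (hvp v) h
  refine ⟨fun v => e ⟨p v, hp v⟩, fun i => ?_, DistrictMap.ext_parts ?_⟩
  · rw [hfib, connectedOn_iff]
    exact P.connected_mem _ (e.symm i).2
  · change Set.range _ = _
    simp only [hfib]
    ext s
    constructor
    · rintro ⟨i, rfl⟩
      exact (e.symm i).2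
    · exact fun hs => ⟨e ⟨s, hs⟩, by simp⟩

open Classical in
theorem preimage_update_singleton {f : V → Fin k} {v : V} {j : Fin k} (hj : f v ≠ j) (i : Fin k) :
    Function.update f v j ⁻¹' {i} =
      if i = f v then f ⁻¹' {f v} \ {v} else if i = j then insert v (f ⁻¹' {j}) else f ⁻¹' {i} := by
  ext y
  rcases eq_or_ne y v with rfl | hy
  · split_ifs with h1 h2
    · simp [h1, hj.symm]
    · simp [h2]
    · simp [Ne.symm h1, Ne.symm h2]
  · split_ifs with h1 h2
    · simp [hy, h1]
    · simp [hy, h2]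
    · simp [hy]

open Classical in
theorem IsDistrictLabeling.update {f : V → Fin k} (hf : IsDistrictLabeling G f) {v w : V}
    (hvw : G.Adj v w) (hne : f v ≠ f w) (hc : ConnectedOn G (f ⁻¹' {f v} \ {v})) :
    IsDistrictLabeling G (Function.update f v (f w)) := by
  intro i
  rw [preimage_update_singleton hne]
  split_ifs
  · exact hc
  · exact (hf _).insert_of_adj rfl hvw
  · exact hf i

open Classical in
theorem IsDistrictLabeling.switch_update {f : V → Fin k} (hf : IsDistrictLabeling G f) {v w : V}
    (hvw : G.Adj v w) (hne : f v ≠ f w) (hc : ConnectedOn G (f ⁻¹' {f v} \ {v})) :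
    Switch hf.toMap (hf.update hvw hne hc).toMap := by
  obtain ⟨a, rfl, u, hu, huv, hau⟩ := (hf (f v)).exists_adj (U := {v}) (by simp) ⟨v, rfl⟩ hc.1
  have hinj : ∀ i j, f ⁻¹' {i} = f ⁻¹' {j} → i = j := by
    intro i j hij
    obtain ⟨b, hb⟩ := (hf i).1
    exact hb.symm.trans (show b ∈ f ⁻¹' {j} from hij ▸ hb)
  refine ⟨u, a, w, f ⁻¹' {f a}, f ⁻¹' {f w}, hau.symm, hvw, ⟨_, rfl⟩, ⟨_, rfl⟩, hu, rfl, rfl,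
    fun h => hne (hinj _ _ h), hc.1, connectedOn_iff.mp hc, ?_⟩
  change Set.range _ = Set.range _ \ _ ∪ _
  ext X
  simp only [preimage_update_singleton hne, Set.mem_range, Set.mem_union, Set.mem_sdiff,
    Set.mem_insert_iff, Set.mem_singleton_iff]
  constructor
  · rintro ⟨i, rfl⟩
    split_ifs with h1 h2
    · exact Or.inr (Or.inl rfl)
    · exact Or.inr (Or.inr rfl)
    · refine Or.inl ⟨⟨i, rfl⟩, ?_⟩
      rintro (h | h)
      · exact h1 (hinj _ _ h)
      · exact h2 (hinj _ _ h)
  · rintro (⟨⟨i, rfl⟩, h⟩ | rfl | rfl)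
    · have h1 : i ≠ f a := fun h1 => h (Or.inl (by rw [h1]))
      have h2 : i ≠ f w := fun h2 => h (Or.inr (by rw [h2]))
      exact ⟨i, by rw [if_neg h1, if_neg h2]⟩
    · exact ⟨f a, if_pos rfl⟩
    · exact ⟨f w, by rw [if_neg hne.symm, if_pos rfl]⟩

/-- The district maps `P` and `Q` are joined by a walk of length at most `m` in the switch
graph. -/
def SwitchWithin (P Q : DistrictMap G k) (m : ℕ) : Prop :=
  ∃ p : (SimpleGraph.fromRel (SwitchAdj (G := G) (k := k))).Walk P Q, p.length ≤ m

theorem SwitchWithin.refl (P : DistrictMap G k) : SwitchWithin P P 0 := ⟨Walk.nil, le_rfl⟩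

theorem SwitchWithin.symm {P Q : DistrictMap G k} {m : ℕ} (h : SwitchWithin P Q m) :
    SwitchWithin Q P m := by
  obtain ⟨p, hp⟩ := h
  exact ⟨p.reverse, by simpa using hp⟩

theorem SwitchWithin.mono {P Q : DistrictMap G k} {m n : ℕ} (h : SwitchWithin P Q m)
    (hmn : m ≤ n) : SwitchWithin P Q n := by
  obtain ⟨p, hp⟩ := h
  exact ⟨p, hp.trans hmn⟩

theorem SwitchWithin.trans {P Q R : DistrictMap G k} {m n : ℕ} (h : SwitchWithin P Q m)
    (h' : SwitchWithin Q R n) : SwitchWithin P R (m + n) := by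
  obtain ⟨p, hp⟩ := h
  obtain ⟨q, hq⟩ := h'
  exact ⟨p.append q, by rw [Walk.length_append]; omega⟩

theorem Switch.switchWithin {P Q : DistrictMap G k} (h : Switch P Q) : SwitchWithin P Q 1 := by
  by_cases hPQ : P = Q
  · subst hPQ
    exact (SwitchWithin.refl P).mono zero_le_one
  · exact ⟨Walk.cons ((SimpleGraph.fromRel_adj _ _ _).mpr ⟨hPQ, Or.inl (Or.inl h)⟩) Walk.nil, le_rfl⟩

theorem SwitchWithin.exists_switchChain {P Q : DistrictMap G k} {m : ℕ} (h : SwitchWithin P Q m) :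
    ∃ (l : ℕ) (f : ℕ → DistrictMap G k), l ≤ m ∧ f 0 = P ∧ f l = Q ∧ SwitchChain f l := by
  obtain ⟨p, hp⟩ := h
  refine ⟨p.length, p.getVert, hp, p.getVert_zero, p.getVert_length, fun i hi => ?_⟩
  have := p.adj_getVert_succ hi
  rw [SimpleGraph.fromRel_adj] at this
  exact this.2.elim id Or.symm

open Classical in
/-- Let `x` and `t` lie in the same district, and let `e` be a neighbour of `x` in another one.
Then `x` and everything that `x` separates from `t` within its district can be moved to the
district of `e`. Vertices that cannot be moved directly are parked in other districts. -/
theorem IsDistrictLabeling.exists_absorb [Finite V] (hG : ∀ c, ConnectedOn G ({c}ᶜ : Set V))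
    {f : V → Fin k} (hf : IsDistrictLabeling G f) {x t e : V} (hxt : x ≠ t) (hfxt : f x = f t)
    (hxe : G.Adj x e) (hne : f x ≠ f e) :
    ∃ hg : IsDistrictLabeling G (fun y =>
        if f y = f t ∧ y ∉ componentIn G (f ⁻¹' {f t} \ {x}) t then f e else f y),
      SwitchWithin hf.toMap hg.toMap
        (2 * ((f ⁻¹' {f t} \ {x}) \ componentIn G (f ⁻¹' {f t} \ {x}) t).ncard + 1) := by
  induction hn : ((f ⁻¹' {f t} \ {x}) \ componentIn G (f ⁻¹' {f t} \ {x}) t).ncard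
    generalizing f with
  | zero =>
    have hsub : f ⁻¹' {f t} \ {x} ⊆ componentIn G (f ⁻¹' {f t} \ {x}) t :=
      Set.sdiff_eq_empty.mp ((Set.ncard_eq_zero).mp hn)
    have heq : componentIn G (f ⁻¹' {f t} \ {x}) t = f ⁻¹' {f t} \ {x} :=
      (componentIn_subset (S := f ⁻¹' {f t} \ {x}) ⟨rfl, hxt.symm⟩).antisymm hsub
    have hc : ConnectedOn G (f ⁻¹' {f x} \ {x}) := by
      rw [hfxt, ← heq]
      exact connectedOn_componentIn
    have hup : (fun y => if f y = f t ∧ y ∉ componentIn G (f ⁻¹' {f t} \ {x}) t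
        then f e else f y) = Function.update f x (f e) := by
      funext y
      rw [heq]
      rcases eq_or_ne y x with rfl | hy
      · simp [hfxt]
      · simp [hy]
    simp only [hup]
    exact ⟨hf.update hxe hne hc, (hf.switch_update hxe hne hc).switchWithin⟩
  | succ n ih =>
    set S := f ⁻¹' {f t} with hS
    set C := componentIn G (S \ {x}) t with hC
    have hCS : C ⊆ S \ {x} := componentIn_subset ⟨rfl, hxt.symm⟩
    obtain ⟨v, hv, hSv, w, hwS, hvw⟩ := exists_removable_of_cut_off hG (hf (f t))
      ((Set.ne_univ_iff_exists_notMem _).mpr ⟨e, fun h => hne (hfxt.trans h.symm)⟩)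
      rfl hfxt hxt (Set.nonempty_of_ncard_ne_zero (by rw [hn]; omega))
    have hvt : f v = f t := hv.1.1
    have hwt : f w ≠ f t := hwS
    have htv : t ≠ v := fun h => hv.2 (h ▸ mem_componentIn_self)
    have hxv : x ≠ v := fun h => hv.1.2 h.symm
    have hev : e ≠ v := fun h => hne (by rw [h, hvt, hfxt])
    have hvw' : f v ≠ f w := fun h => hwt (h.symm.trans hvt)
    have hSv' : ConnectedOn G (f ⁻¹' {f v} \ {v}) := by rw [hvt]; exact hSv
    have hf' := hf.update hvw hvw' hSv'
    have hsw := (hf.switch_update hvw hvw' hSv').switchWithin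
    have hft : Function.update f v (f w) t = f t := by simp [htv]
    have hfx : Function.update f v (f w) x = f x := by simp [hxv]
    have hfe : Function.update f v (f w) e = f e := by simp [hev]
    have hfib : Function.update f v (f w) ⁻¹' {f t} = S \ {v} := by
      rw [preimage_update_singleton hvw', if_pos hvt.symm, hvt]
    have hcomp : componentIn G ((S \ {v}) \ {x}) t = C := by
      refine Set.Subset.antisymm ?_ ?_
      · exact componentIn_subset_of_closedIn mem_componentIn_self fun a ha b hb hab =>
          closedIn_componentIn a ha b ⟨hb.1.1, hb.2⟩ hab
      · refine (componentIn_subset_of_closedIn (U := C ∩ componentIn G ((S \ {v}) \ {x}) t)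
          ⟨mem_componentIn_self, mem_componentIn_self⟩ ?_).trans Set.inter_subset_right
        intro a ha b hb hab
        have hbC : b ∈ C := closedIn_componentIn a ha.1 b hb hab
        exact ⟨hbC, closedIn_componentIn a ha.2 b ⟨⟨hb.1, fun h => hv.2 (h ▸ hbC)⟩, hb.2⟩ hab⟩
    have hcard : (((S \ {v}) \ {x}) \ C).ncard = n := by
      have : ((S \ {v}) \ {x}) \ C = ((S \ {x}) \ C) \ {v} := by
        ext y
        simp only [Set.mem_sdiff]
        tauto
      rw [this, Set.ncard_sdiff_singleton_of_mem hv, hn, Nat.add_sub_cancel]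
    obtain ⟨hg, hstep⟩ := ih hf' (by rw [hfx, hft, hfxt]) (by rwa [hfx, hfe])
      (by rw [hft, hfib, hcomp, hcard])
    simp only [hft, hfe, hfib, hcomp] at hg hstep
    set g : V → Fin k := fun y => if Function.update f v (f w) y = f t ∧ y ∉ C then f e
      else Function.update f v (f w) y with hgdef
    have hgv : g v = f w := by simp [hgdef, hwt]
    have hgy : ∀ y, y ≠ v → g y = if f y = f t ∧ y ∉ C then f e else f y := by
      intro y hy
      simp [hgdef, hy]
    have hfin : (fun y => if f y = f t ∧ y ∉ C then f e else f y) =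
        Function.update g v (f e) := by
      funext y
      rcases eq_or_ne y v with rfl | hy
      · simp [hvt, show y ∉ C from hv.2]
      · simp [hy, hgy y hy]
    rw [hfin]
    have hwithin := hsw.trans hstep
    by_cases hwe : f w = f e
    · have : Function.update g v (f e) = g := by rw [← hwe, ← hgv, Function.update_eq_self]
      simp only [this]
      exact ⟨hg, hwithin.mono (by omega)⟩
    · obtain ⟨a, rfl, b, hb, hbv, hab⟩ := (hf (f v)).exists_adj (U := {v}) (by simp) ⟨v, rfl⟩
        hSv'.1
      have hbC : b ∉ C := fun h => hv.2 (closedIn_componentIn b h a hv.1 hab.symm)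
      have hgb : g b = f e := by
        rw [hgy b hbv, if_pos ⟨hb.trans hvt, hbC⟩]
      have hgab : g a ≠ g b := by rwa [hgv, hgb]
      have hfw : g ⁻¹' {g a} \ {a} = f ⁻¹' {f w} := by
        ext y
        rcases eq_or_ne y a with rfl | hy
        · simp [hvw']
        · have hew : f e ≠ f w := fun h => hwe h.symm
          simp only [Set.mem_sdiff, Set.mem_preimage, Set.mem_singleton_iff, hgv, hgy y hy, hy,
            not_false_eq_true, and_true]
          split_ifs with h
          · simp [hew, h.1, hwt.symm]
          · rfl
      have hca : ConnectedOn G (g ⁻¹' {g a} \ {a}) := hfw ▸ hf (f w)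
      have hlast := (hg.switch_update hab hgab hca).switchWithin
      have hup := hg.update hab hgab hca
      simp only [hgb] at hlast hup
      exact ⟨hup, (hwithin.trans hlast).mono (by omega)⟩

/-- If the vertices outside `insert t F` induce a connected subgraph and `F` consists of singleton
districts, then the district of `t` can be shrunk to `{t}` without changing the districts in `F`. -/
theorem IsDistrictLabeling.exists_shrink [Finite V] (hG : ∀ c, ConnectedOn G ({c}ᶜ : Set V))
    {F : Set V} {t : V} (hF : ConnectedOn G (Fᶜ \ {t})) (htF : t ∉ F)
    {f : V → Fin k} (hf : IsDistrictLabeling G f) (hsing : ∀ a ∈ F, ∀ b, f b = f a → b = a)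
    (hex : ∃ y ∉ F, f y ≠ f t) :
    ∃ (g : V → Fin k) (hg : IsDistrictLabeling G g),
      (∀ a ∈ insert t F, ∀ b, g b = g a → b = a) ∧
        SwitchWithin hf.toMap hg.toMap (2 * (f ⁻¹' {f t}).ncard) := by
  classical
  induction hn : (f ⁻¹' {f t}).ncard using Nat.strong_induction_on generalizing f with
  | _ n ih =>
  by_cases hS : f ⁻¹' {f t} ⊆ {t}
  · refine ⟨f, hf, ?_, (SwitchWithin.refl _).mono (Nat.zero_le _)⟩
    rintro a (rfl | ha) b hb
    · exact hS hb
    · exact hsing a ha b hb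
  · obtain ⟨z, hz, hzt⟩ := Set.not_subset.mp hS
    obtain ⟨y, hyF, hyt⟩ := hex
    obtain ⟨x, ⟨hxS, hxt⟩, e, ⟨heF, het⟩, heS, hxe⟩ := hF.exists_adj
      (U := f ⁻¹' {f t} \ {t})
      (fun b hb => ⟨fun hbF => hb.2 (hsing b hbF t (hb.1 : f b = f t).symm).symm, hb.2⟩)
      ⟨z, hz, hzt⟩ ⟨y, ⟨hyF, fun h => hyt (by rw [h])⟩, fun h => hyt h.1⟩
    have hfe : f e ≠ f t := fun h => heS ⟨h, het⟩
    have hfx : f x = f t := hxS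
    obtain ⟨hg, hstep⟩ := hf.exists_absorb hG hxt hfx hxe (by rw [hfx]; exact hfe.symm)
    set C := componentIn G (f ⁻¹' {f t} \ {x}) t with hC
    have hCS : C ⊆ f ⁻¹' {f t} \ {x} := componentIn_subset ⟨rfl, Ne.symm hxt⟩
    set g : V → Fin k := fun y => if f y = f t ∧ y ∉ C then f e else f y with hgdef
    replace hstep : SwitchWithin hf.toMap hg.toMap
      (2 * ((f ⁻¹' {f t} \ {x}) \ C).ncard + 1) := hstep
    have htC : t ∈ C := mem_componentIn_self
    have hgt : g t = f t := by simp [hgdef, htC]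
    have hg_of_ne : ∀ b, f b ≠ f t → g b = f b := fun b hb => by simp [hgdef, hb]
    have hgfib : g ⁻¹' {g t} = C := by
      ext b
      rw [hgt]
      by_cases hb : f b = f t
      · by_cases hbC : b ∈ C
        · simp [hgdef, hb, hbC]
        · simp [hgdef, hb, hbC, hfe]
      · have hbC : b ∉ C := fun h => hb (hCS h).1
        simp [hgdef, hb, hbC]
    have hcard : C.ncard + ((f ⁻¹' {f t} \ {x}) \ C).ncard + 1 = n := by
      rw [← hn, add_comm C.ncard, Set.ncard_sdiff_add_ncard_of_subset hCS,
        Set.ncard_sdiff_singleton_add_one hxS]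
    have hsing' : ∀ a ∈ F, ∀ b, g b = g a → b = a := by
      intro a ha b hb
      have hat : f a ≠ f t := fun h => htF (hsing a ha t h.symm ▸ ha)
      rw [hg_of_ne a hat] at hb
      by_cases hbC : f b = f t ∧ b ∉ C
      · rw [hgdef] at hb
        simp only [if_pos hbC] at hb
        exact absurd (hsing a ha e hb ▸ ha) heF
      · rw [hgdef] at hb
        simp only [if_neg hbC] at hb
        exact hsing a ha b hb
    obtain ⟨g', hg', hsing'', hstep'⟩ := ih C.ncard (by omega) hg hsing'
      ⟨y, hyF, by rwa [hg_of_ne y hyt, hgt]⟩ (by rw [hgfib])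
    exact ⟨g', hg', hsing'', (hstep.trans hstep').mono (by omega)⟩

theorem exists_singleton_districts [Finite V] (hV : ConnectedOn G Set.univ)
    (hG : ∀ c, ConnectedOn G ({c}ᶜ : Set V)) (hk : k ≤ Nat.card V) (j : ℕ) (hj : j + 1 ≤ k) :
    ∃ F : Set V, F.ncard = j ∧ ConnectedOn G Fᶜ ∧
      ∀ (f : V → Fin k) (hf : IsDistrictLabeling G f),
        ∃ (g : V → Fin k) (hg : IsDistrictLabeling G g), (∀ a ∈ F, ∀ b, g b = g a → b = a) ∧
          SwitchWithin hf.toMap hg.toMap (2 * j * Nat.card V) := by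
  induction j with
  | zero =>
    refine ⟨∅, by simp, by simpa using hV, fun f hf => ⟨f, hf, by simp, ?_⟩⟩
    exact (SwitchWithin.refl _).mono (Nat.zero_le _)
  | succ j ih =>
    obtain ⟨F, hFj, hF, h⟩ := ih (by omega)
    have hcard := Set.ncard_add_ncard_compl F
    obtain ⟨t, ht, hFt⟩ := hF.exists_diff_singleton (by omega)
    refine ⟨insert t F, by rw [Set.ncard_insert_of_notMem ht, hFj], ?_, fun f hf => ?_⟩
    · rwa [← Set.union_singleton, Set.compl_union, ← Set.sdiff_eq]
    · obtain ⟨g, hg, hsing, hfg⟩ := h f hf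
      have hex : ∃ y ∉ F, g y ≠ g t := by
        by_contra! hcon
        have hsub : (Set.univ : Set (Fin k)) ⊆ g '' insert t F := by
          intro i _
          obtain ⟨y, rfl⟩ := (hg i).1
          by_cases hy : y ∈ F
          · exact ⟨y, Or.inr hy, rfl⟩
          · exact ⟨t, Or.inl rfl, (hcon y hy).symm⟩
        have h1 := Set.ncard_le_ncard hsub
        have h2 := Set.ncard_image_le (f := g) (Set.toFinite (insert t F))
        rw [Set.ncard_univ, Nat.card_fin] at h1
        rw [Set.ncard_insert_of_notMem ht] at h2
        omega
      obtain ⟨g', hg', hsing', hgg'⟩ := hg.exists_shrink hG hFt ht hsing hex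
      refine ⟨g', hg', hsing', (hfg.trans hgg').mono ?_⟩
      have := Set.ncard_le_card (g ⁻¹' {g t})
      nlinarith

/-- A labelling with `k - 1` prescribed singleton districts determines a unique district map. -/
theorem IsDistrictLabeling.toMap_eq_of_singletons [Finite V] {F : Set V} (hF : F.ncard + 1 = k)
    {f g : V → Fin k} (hf : IsDistrictLabeling G f) (hg : IsDistrictLabeling G g)
    (hsf : ∀ a ∈ F, ∀ b, f b = f a → b = a) (hsg : ∀ a ∈ F, ∀ b, g b = g a → b = a) :
    hf.toMap = hg.toMap := by
  have key : ∀ h : V → Fin k, (∀ a ∈ F, ∀ b, h b = h a → b = a) → ∀ a b, h a = h b ↔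
      a = b ∨ (a ∉ F ∧ b ∉ F) := by
    intro h hs a b
    constructor
    · intro hab
      by_cases ha : a ∈ F
      · exact Or.inl (hs a ha b hab.symm).symm
      · by_cases hb : b ∈ F
        · exact Or.inl (hs b hb a hab)
        · exact Or.inr ⟨ha, hb⟩
    · rintro (rfl | ⟨ha, hb⟩)
      · rfl
      · have hinj : Set.InjOn h F := fun c _ d hd hcd => hs d hd c hcd
        have hcompl := Set.ncard_add_ncard_compl (h '' F)
        rw [hinj.ncard_image, Nat.card_fin] at hcompl
        obtain ⟨i, hi⟩ := Set.ncard_eq_one.mp (show (h '' F)ᶜ.ncard = 1 by omega)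
        have hmem : ∀ c ∉ F, h c = i := fun c hc => by
          have : h c ∈ (h '' F)ᶜ := by
            rintro ⟨d, hd, hdc⟩
            exact hc (hs d hd c hdc.symm ▸ hd)
          rwa [hi] at this
        rw [hmem a ha, hmem b hb]
  have hsub : ∀ h h' : V → Fin k, IsDistrictLabeling G h → (∀ a b, h a = h b ↔ h' a = h' b) →
      Set.range (fun i => h ⁻¹' {i}) ⊆ Set.range (fun i => h' ⁻¹' {i}) := by
    rintro h h' hh heq _ ⟨i, rfl⟩
    obtain ⟨a, rfl⟩ := (hh i).1
    exact ⟨h' a, Set.ext fun b => (heq b a).symm⟩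
  have hfg : ∀ a b, f a = f b ↔ g a = g b := fun a b =>
    (key f hsf a b).trans (key g hsg a b).symm
  exact DistrictMap.ext_parts ((hsub f g hf hfg).antisymm (hsub g f hg fun a b => (hfg a b).symm))

end Labelings

theorem Biconnected.connectedOn_compl_singleton {V : Type*} {G : SimpleGraph V}
    (h : Biconnected G) (c : V) : ConnectedOn G ({c}ᶜ : Set V) := by
  rcases h.2 with ⟨a, b, hab, -, huniv⟩ | ⟨-, hc⟩
  · have hmem : ∀ y : V, y = a ∨ y = b := fun y => by
      have : y ∈ (Set.univ : Set V) := Set.mem_univ y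
      rwa [huniv] at this
    rcases hmem c with rfl | rfl
    · rw [show ({c}ᶜ : Set V) = {b} by ext y; have := hmem y; simp; grind]
      exact connectedOn_singleton b
    · rw [show ({c}ᶜ : Set V) = {a} by ext y; have := hmem y; simp; grind]
      exact connectedOn_singleton a
  · exact connectedOn_iff.mpr (hc c)

/-- There is an absolute constant `C > 0` such that for every biconnected
graph `G` on `n` vertices and every `1 ≤ k ≤ n`, the switch graph `Γ_k(G)` is connected
with diameter at most `C·k·n`. -/
theorem biconnected_switchGraph_connected_diameter :
    ∃ C : ℕ, 0 < C ∧
      ∀ (V : Type) [Fintype V], ∀ (G : SimpleGraph V), Biconnected G →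
        ∀ k : ℕ, 1 ≤ k → k ≤ Nat.card V →
          ∀ P Q : DistrictMap G k,
            ∃ (m : ℕ) (f : ℕ → DistrictMap G k),
              m ≤ C * k * Nat.card V ∧ f 0 = P ∧ f m = Q ∧ SwitchChain f m := by
  refine ⟨4, by norm_num, fun V _ G hG k hk1 hkn P Q => ?_⟩
  have hV : ConnectedOn G Set.univ := by
    rw [connectedOn_iff]
    exact (SimpleGraph.induceUnivIso G).connected_iff.mpr hG.1
  obtain ⟨F, hFk, -, hF⟩ := exists_singleton_districts hV hG.connectedOn_compl_singleton hkn
    (k - 1) (by omega)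
  obtain ⟨p, hp, rfl⟩ := P.exists_labeling
  obtain ⟨q, hq, rfl⟩ := Q.exists_labeling
  obtain ⟨p', hp', hsp, hpp'⟩ := hF p hp
  obtain ⟨q', hq', hsq, hqq'⟩ := hF q hq
  rw [IsDistrictLabeling.toMap_eq_of_singletons (by omega) hp' hq' hsp hsq] at hpp'
  refine ((hpp'.trans hqq'.symm).mono ?_).exists_switchChain
  calc _ = 4 * (k - 1) * Nat.card V := by ring
    _ ≤ 4 * k * Nat.card V := by gcongr; omega
end

section
/- There exists an absolute constant C > 0 such that for every finite simple connected graph G with n vertices and every k ∈ ℕ with 1 ≤ k ≤ n, the switch graph Γ_k'(G) over the contractible k-district maps of G is connected and its diameter is at most C·k·n. -/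
open SimpleGraph

universe u

namespace DistrictSwitch

section Sets

variable {V : Type u} {G : SimpleGraph V}

/-- A set of vertices is connected if it is nonempty and has no proper nonempty subset
closed under adjacency. -/
def ConnSet (G : SimpleGraph V) (s : Set V) : Prop :=
  s.Nonempty ∧ ∀ A ⊆ s, A.Nonempty → (∀ x ∈ A, ∀ y ∈ s, G.Adj x y → y ∈ A) → s ⊆ A

theorem connSet_iff_connected {s : Set V} : ConnSet G s ↔ (G.induce s).Connected := by
  constructor
  · rintro ⟨⟨a, ha⟩, h⟩
    have : Nonempty s := ⟨⟨a, ha⟩⟩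
    refine ⟨fun x y => ?_⟩
    have key := h {z | ∃ hz : z ∈ s, (G.induce s).Reachable x ⟨z, hz⟩}
      (fun z hz => hz.1) ⟨x, x.2, Reachable.refl _⟩
      (by
        rintro z ⟨hz, hr⟩ w hw hzw
        exact ⟨hw, hr.trans (Adj.reachable (by simpa using hzw))⟩)
    exact (key y.2).2
  · intro h
    obtain ⟨a⟩ := h.nonempty
    refine ⟨⟨a, a.2⟩, fun A hA ⟨x, hx⟩ hcl y hy => ?_⟩
    have hr := (reachable_iff_reflTransGen _ _).1 (h.preconnected ⟨x, hA hx⟩ ⟨y, hy⟩)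
    have : ∀ z : s, Relation.ReflTransGen (G.induce s).Adj ⟨x, hA hx⟩ z → (z : V) ∈ A := by
      intro z hz
      induction hz with
      | refl => exact hx
      | tail _ hab ih => exact hcl _ ih _ (Subtype.property _) (by simpa using hab)
    exact this _ hr

theorem ConnSet.singleton (v : V) : ConnSet G {v} := by
  refine ⟨⟨v, rfl⟩, fun A hA ⟨x, hx⟩ _ y hy => ?_⟩
  have h1 : x = v := hA hx
  have h2 : y = v := hy
  rw [h2, ← h1]; exact hx

/-- A set is connected once every closed subset missing a fixed vertex is empty. -/
theorem ConnSet.of_missing {s : Set V} {c : V} (hc : c ∈ s)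
    (h : ∀ D ⊆ s, c ∉ D → D.Nonempty → (∀ x ∈ D, ∀ y ∈ s, G.Adj x y → y ∈ D) → False) :
    ConnSet G s := by
  refine ⟨⟨c, hc⟩, fun A hA hne hcl y hy => ?_⟩
  have hcA : c ∈ A := by
    by_contra hcA
    exact h A hA hcA hne hcl
  by_contra hyA
  refine h (s \ A) Set.sdiff_subset (fun hh => hh.2 hcA) ⟨y, hy, hyA⟩ ?_
  rintro x ⟨hx, hxA⟩ z hz hxz
  exact ⟨hz, fun hzA => hxA (hcl z hzA x hx hxz.symm)⟩

theorem ConnSet.insert {s : Set V} (hs : ConnSet G s) {v w : V} (hw : w ∈ s)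
    (hvw : G.Adj v w) : ConnSet G (insert v s) := by
  by_cases hv : v ∈ s
  · rwa [Set.insert_eq_of_mem hv]
  refine ConnSet.of_missing (c := w) (Or.inr hw) fun D hD hwD hne hcl => ?_
  by_cases hvD : v ∈ D
  · exact hwD (hcl v hvD w (Or.inr hw) hvw)
  · have hDs : D ⊆ s := fun x hx => (hD hx).resolve_left (fun h => hvD (h ▸ hx))
    exact hwD (hs.2 D hDs hne (fun x hx y hy => hcl x hx y (Or.inr hy)) hw)

theorem ConnSet.exists_adj {s : Set V} (hs : ConnSet G s) {v : V} (hv : v ∈ s)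
    (hne : (s \ {v}).Nonempty) : ∃ u ∈ s \ {v}, G.Adj u v := by
  by_contra hcon
  push Not at hcon
  obtain ⟨x, hx, hxv⟩ := hne
  refine hxv (hs.2 {v} (by simpa using hv) ⟨v, rfl⟩ ?_ hx)
  rintro a rfl y hy hay
  by_contra hya
  exact hcon y ⟨hy, hya⟩ hay.symm

/-- The connected component of a vertex inside a set of vertices. -/
theorem exists_component {s : Set V} {z : V} (hz : z ∈ s) :
    ∃ S ⊆ s, z ∈ S ∧ ConnSet G S ∧ ∀ x ∈ S, ∀ y ∈ s, G.Adj x y → y ∈ S := by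
  let S : Set V := {x | ∀ B ⊆ s, z ∈ B → (∀ x ∈ B, ∀ y ∈ s, G.Adj x y → y ∈ B) → x ∈ B}
  have hSs : S ⊆ s := fun x hx => hx s subset_rfl hz (fun _ _ _ hy _ => hy)
  have hcl : ∀ x ∈ S, ∀ y ∈ s, G.Adj x y → y ∈ S := fun x hx y hy hxy B hB hzB hBcl =>
    hBcl x (hx B hB hzB hBcl) y hy hxy
  have hzS : z ∈ S := fun B _ hzB _ => hzB
  refine ⟨S, hSs, hzS, ConnSet.of_missing hzS fun D hD hzD hne hDcl => ?_, hcl⟩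
  obtain ⟨x, hx⟩ := hne
  refine (hD hx (S \ D) (fun a ha => hSs ha.1) ⟨hzS, hzD⟩ ?_).2 hx
  rintro a ⟨haS, haD⟩ y hy hay
  have hyS := hcl a haS y hy hay
  exact ⟨hyS, fun hyD => haD (hDcl y hyD a haS hay.symm)⟩

/-- Every branch `R` of a connected set `A` hanging off a vertex `y` contains a sub-branch
each of whose vertices can be deleted from `A` without disconnecting it. -/
theorem exists_removable_branch [Finite V] {A R : Set V} {y : V} (hA : ConnSet G A) (hRA : R ⊆ A)
    (hR : R.Nonempty) (hyA : y ∈ A) (hyR : y ∉ R)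
    (hcl : ∀ x ∈ R, ∀ z ∈ A, G.Adj x z → z ∈ R ∨ z = y) :
    ∃ K ⊆ R, K.Nonempty ∧ (∃ c ∈ A, c ∉ K ∧ ∀ x ∈ K, ∀ z ∈ A, G.Adj x z → z ∈ K ∨ z = c) ∧
      ∀ v ∈ K, ConnSet G (A \ {v}) := by
  let F : Set (Set V) := {K | K ⊆ R ∧ K.Nonempty ∧
    ∃ c ∈ A, c ∉ K ∧ ∀ x ∈ K, ∀ z ∈ A, G.Adj x z → z ∈ K ∨ z = c}
  have hF : F.Nonempty := ⟨R, subset_rfl, hR, y, hyA, hyR, hcl⟩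
  obtain ⟨K, hKF, hmin⟩ := Set.exists_min_image F Set.ncard (Set.toFinite F) hF
  obtain ⟨hKR, hKne, c, hcA, hcK, hKcl⟩ := hKF
  refine ⟨K, hKR, hKne, ⟨c, hcA, hcK, hKcl⟩, fun v hv => ?_⟩
  have hcv : c ≠ v := fun h => hcK (h ▸ hv)
  refine ConnSet.of_missing (c := c) ⟨hcA, hcv⟩ fun D hD hcD hne hDcl => ?_
  by_cases hDK : (D ∩ K).Nonempty
  · have hle := hmin (D ∩ K) ⟨fun x hx => hKR hx.2, hDK, v, hRA (hKR hv),
      fun h => (hD h.1).2 rfl, ?_⟩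
    · have hlt : (D ∩ K).ncard < K.ncard := Set.ncard_lt_ncard
        ⟨Set.inter_subset_right, fun h => (hD (h hv).1).2 rfl⟩ (Set.toFinite _)
      omega
    · rintro x ⟨hxD, hxK⟩ z hz hxz
      by_cases hzv : z = v
      · exact Or.inr hzv
      · have hzD := hDcl x hxD z ⟨hz, hzv⟩ hxz
        rcases hKcl x hxK z hz hxz with h | h
        · exact Or.inl ⟨hzD, h⟩
        · exact absurd (h ▸ hzD) hcD
  · refine hcD (hA.2 D (fun x hx => (hD hx).1) hne ?_ hcA)
    intro x hx z hz hxz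
    by_cases hzv : z = v
    · subst hzv
      rcases hKcl z hv x (hD hx).1 hxz.symm with h | h
      · exact absurd ⟨x, hx, h⟩ hDK
      · exact absurd (h ▸ hx) hcD
    · exact hDcl x hx z ⟨hz, hzv⟩ hxz

theorem ConnSet.exists_removable [Finite V] {A : Set V} (hA : ConnSet G A) (h2 : 2 ≤ A.ncard) :
    ∃ v ∈ A, ConnSet G (A \ {v}) := by
  obtain ⟨y, x, hy, hx, hyx⟩ := (Set.one_lt_ncard_iff (Set.toFinite A)).1 h2
  obtain ⟨K, hK, ⟨v, hv⟩, -, h⟩ := exists_removable_branch hA (R := A \ {y}) Set.sdiff_subset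
    ⟨x, hx, hyx.symm⟩ hy (fun h => h.2 rfl) (by
      intro a _ z hz _
      by_cases h : z = y
      · exact Or.inr h
      · exact Or.inl ⟨hz, h⟩)
  exact ⟨v, (hK hv).1, h v hv⟩

/-- `K` is a nonempty set of vertices not containing `c` that can only be left through `c`. -/
def Lobe (G : SimpleGraph V) (c : V) (K : Set V) : Prop :=
  K.Nonempty ∧ c ∉ K ∧ ∀ x ∈ K, ∀ y, G.Adj x y → y ∈ K ∨ y = c

/-- A set of vertices that meets every lobe: after the deletion of any vertex, each
remaining component still meets the set. -/
def Hub (G : SimpleGraph V) (T : Set V) : Prop :=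
  ∀ c K, Lobe G c K → (K ∩ T).Nonempty

/-- A lobe containing no smaller lobe. -/
def MinLobe (G : SimpleGraph V) (c : V) (K : Set V) : Prop :=
  Lobe G c K ∧ ∀ c' K', Lobe G c' K' → K' ⊆ K → K' = K

theorem Hub.mono {S T : Set V} (h : Hub G S) (hST : S ⊆ T) : Hub G T := fun c K hK =>
  (h c K hK).mono (Set.inter_subset_inter_right K hST)

theorem MinLobe.connSet {c : V} {K : Set V} (h : MinLobe G c K) : ConnSet G K := by
  refine ⟨h.1.1, fun A hA hne hcl => ?_⟩
  refine (h.2 c A ⟨hne, fun hc => h.1.2.1 (hA hc), fun x hx y hxy => ?_⟩ hA).symm.subset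
  exact (h.1.2.2 x (hA hx) y hxy).imp_left fun hy => hcl x hx y hy hxy

/-- A nonempty set closed under adjacency is everything in a connected graph. -/
theorem eq_univ_of_closed (hG : G.Connected) {A : Set V} (hne : A.Nonempty)
    (hcl : ∀ x ∈ A, ∀ y, G.Adj x y → y ∈ A) : A = Set.univ := by
  obtain ⟨a, ha⟩ := hne
  refine Set.eq_univ_of_forall fun y => ?_
  have hr := (reachable_iff_reflTransGen _ _).1 (hG.preconnected a y)
  induction hr with
  | refl => exact ha
  | tail _ hab ih => exact hcl _ ih _ hab

/-- Inside a minimal lobe, a vertex of a hub may be replaced by any other vertex. -/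
theorem Hub.exchange (hG : G.Connected) {T : Set V} (hT : Hub G T) {c₀ : V} {K : Set V}
    (hK : MinLobe G c₀ K) {t t' : V} (ht' : t' ∈ K) (hne : (T \ {t, t'}).Nonempty)
    (htK : t ∈ K) : Hub G (insert t' (T \ {t})) := by
  intro c L hL
  by_contra hcon
  have hnot : ∀ x ∈ L, x ∈ insert t' (T \ {t}) → False := fun x hx hx' => hcon ⟨x, hx, hx'⟩
  have htL : t ∈ L := by
    obtain ⟨s, hsL, hsT⟩ := hT c L hL
    by_cases hst : s = t
    · exact hst ▸ hsL
    · exact (hnot s hsL (Or.inr ⟨hsT, hst⟩)).elim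
  have ht'L : t' ∉ L := fun h => hnot t' h (Or.inl rfl)
  by_cases hcK : c ∈ K
  · have hcc₀ : c ≠ c₀ := fun h => hK.1.2.1 (h ▸ hcK)
    have aux : ∀ M : Set V, c ∉ M → c₀ ∉ M → (∀ x ∈ M, ∀ y, G.Adj x y → y ∈ M ∨ y = c) →
        (M ∩ K).Nonempty → False := by
      intro M hcM hc₀M hM hMK
      have := hK.2 c (M ∩ K) ⟨hMK, fun h => hcM h.1, ?_⟩ Set.inter_subset_right
      · exact hcM (this.symm.subset hcK).1
      · rintro x ⟨hxM, hxK⟩ y hxy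
        rcases hM x hxM y hxy with h | h
        · rcases hK.1.2.2 x hxK y hxy with h' | h'
          · exact Or.inl ⟨h, h'⟩
          · exact absurd (h' ▸ h) hc₀M
        · exact Or.inr h
    by_cases hc₀L : c₀ ∈ L
    · let M : Set V := {x | x ∉ L ∧ x ≠ c}
      have hM : ∀ x ∈ M, ∀ y, G.Adj x y → y ∈ M ∨ y = c := by
        rintro x ⟨hxL, hxc⟩ y hxy
        by_cases hyc : y = c
        · exact Or.inr hyc
        · exact Or.inl ⟨fun hyL => (hL.2.2 y hyL x hxy.symm).elim hxL hxc, hyc⟩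
      have hMK : ¬ (M ∩ K).Nonempty :=
        aux M (fun h => h.2 rfl) (fun h => h.1 hc₀L) hM
      have ht'c : t' = c := by
        by_contra h
        exact hMK ⟨t', ⟨ht'L, h⟩, ht'⟩
      have hMempty : ¬ M.Nonempty := by
        intro hMne
        have huniv := eq_univ_of_closed hG hMne (by
          intro x hx y hxy
          refine (hM x hx y hxy).resolve_right ?_
          rintro rfl
          rcases hK.1.2.2 y hcK x hxy.symm with h | h
          · exact hMK ⟨x, hx, h⟩
          · exact hx.1 (h ▸ hc₀L))
        have : c ∈ M := huniv ▸ Set.mem_univ c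
        exact this.2 rfl
      obtain ⟨s, hsT, hs⟩ := hne
      have hsL : s ∈ L := by
        by_contra h
        exact hMempty ⟨s, h, fun h' => hs (Or.inr (h'.trans ht'c.symm))⟩
      exact hnot s hsL (Or.inr ⟨hsT, fun h => hs (Or.inl h)⟩)
    · exact aux L hL.2.1 hc₀L hL.2.2 ⟨t, htL, htK⟩
  · have := hK.2 c₀ (L ∩ K) ⟨⟨t, htL, htK⟩, fun h => hK.1.2.1 h.2, ?_⟩ Set.inter_subset_right
    · exact ht'L (this.symm.subset ht').1
    · rintro x ⟨hxL, hxK⟩ y hxy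
      refine (hK.1.2.2 x hxK y hxy).imp_left fun hyK => ⟨?_, hyK⟩
      exact (hL.2.2 x hxL y hxy).resolve_right fun h => hcK (h ▸ hyK)

/-- If `Z ∪ {r}` is a hub, then two lobes missing `Z` and a common vertex `w` cannot be
told apart by vertices lying in exactly one of them. -/
theorem Hub.not_crossing (hG : G.Connected) {Z : Set V} {r w s t c d : V} {K L : Set V}
    (hZ : Hub G (insert r Z)) (hK : Lobe G c K) (hL : Lobe G d L)
    (hKZ : Disjoint K Z) (hLZ : Disjoint L Z) (hwK : w ∉ K) (hwL : w ∉ L)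
    (hs : s ∈ K) (hsL : s ∉ L) (ht : t ∈ L) (htK : t ∉ K) : False := by
  have hr : ∀ {e M}, Lobe G e M → Disjoint M Z → r ∈ M := by
    intro e M hM hMZ
    obtain ⟨x, hxM, rfl | hxZ⟩ := hZ e M hM
    · exact hxM
    · exact (Set.disjoint_left.1 hMZ hxM hxZ).elim
  have aux : ∀ {e f x M N}, Lobe G e M → Lobe G f N → Disjoint M Z → Disjoint N Z →
      x ∈ M → x ∉ N → f ∈ M := by
    intro e f x M N hM hN hMZ hNZ hxM hxN
    by_contra hf
    have hMN : Lobe G e (M \ N) := by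
      refine ⟨⟨x, hxM, hxN⟩, fun h => hM.2.1 h.1, ?_⟩
      rintro a ⟨haM, haN⟩ b hab
      refine (hM.2.2 a haM b hab).imp_left fun hbM => ⟨hbM, fun hbN => ?_⟩
      rcases hN.2.2 b hbN a hab.symm with h | h
      · exact haN h
      · exact hf (h ▸ haM)
    exact (hr hMN (hMZ.mono_left Set.sdiff_subset)).2 (hr hN hNZ)
  have hd := aux hK hL hKZ hLZ hs hsL
  have hc := aux hL hK hLZ hKZ ht htK
  have huniv := eq_univ_of_closed hG (A := K ∪ L) ⟨s, Or.inl hs⟩ (by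
    rintro x (hx | hx) y hxy
    · rcases hK.2.2 x hx y hxy with h | h
      · exact Or.inl h
      · exact Or.inr (h ▸ hc)
    · rcases hL.2.2 x hx y hxy with h | h
      · exact Or.inr h
      · exact Or.inl (h ▸ hd))
  have : w ∈ K ∪ L := huniv ▸ Set.mem_univ w
  exact this.elim hwK hwL

/-- Deleting from a connected set a lobe attached at one of its vertices keeps it connected. -/
theorem ConnSet.diff_lobe {C K : Set V} {c : V} (hC : ConnSet G C) (hK : Lobe G c K)
    (hc : c ∈ C) : ConnSet G (C \ K) := by
  refine ConnSet.of_missing (c := c) ⟨hc, hK.2.1⟩ fun D hD hcD hne hcl => ?_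
  refine hcD (hC.2 D (fun x hx => (hD hx).1) hne ?_ hc)
  intro x hx y hy hxy
  refine hcl x hx y ⟨hy, fun hyK => ?_⟩ hxy
  rcases hK.2.2 y hyK x hxy.symm with h | h
  · exact (hD hx).2 h
  · exact hcD (h ▸ hx)

theorem exists_adj_dist_lt (hG : G.Connected) {x r : V} (h : x ≠ r) :
    ∃ y, G.Adj x y ∧ G.dist y r < G.dist x r := by
  obtain ⟨p, hp⟩ := (hG.preconnected x r).exists_walk_length_eq_dist
  cases p with
  | nil => exact (h rfl).elim
  | cons hxy q =>
    refine ⟨_, hxy, ?_⟩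
    have := dist_le q
    simp only [Walk.length_cons] at hp
    omega

theorem Lobe.dist_lt (hG : G.Connected) {c r : V} {K : Set V} (hK : Lobe G c K) (hr : r ∉ K) :
    ∀ n, ∀ x ∈ K, G.dist x r = n → G.dist c r < n := by
  intro n
  induction n using Nat.strong_induction_on with
  | _ n ih =>
    intro x hx hn
    obtain ⟨y, hxy, hlt⟩ := exists_adj_dist_lt hG (x := x) (r := r) (fun h => hr (h ▸ hx))
    rcases hK.2.2 x hx y hxy with h | h
    · exact (ih _ (hn ▸ hlt) y h rfl).trans (hn ▸ hlt)
    · rw [← h, ← hn]; exact hlt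

/-- A hub containing `r` can be replaced by one, no larger, whose remaining vertices lie in
separate minimal lobes and have a connected complement. -/
theorem exists_separated_hub [Finite V] (hG : G.Connected) {T : Set V} (hT : Hub G T) {r : V}
    (hr : r ∈ T) : ∃ Z : Set V, Z.ncard + 1 ≤ T.ncard ∧ Hub G (insert r Z) ∧ ConnSet G Zᶜ ∧
      ∀ z ∈ Z, ∃ c K, MinLobe G c K ∧ z ∈ K ∧ ∀ z' ∈ Z, z' ∈ K → z' = z := by
  classical
  have := Fintype.ofFinite V
  let N : ℕ := ∑ x, G.dist x r
  have hN : ∀ x, G.dist x r ≤ N := fun x =>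
    Finset.single_le_sum (f := fun x => G.dist x r) (fun _ _ => Nat.zero_le _) (Finset.mem_univ x)
  let wt : V → ℕ := fun x => N + 1 - G.dist x r
  let F : Set (Finset V) := {S | Hub G (insert r (S : Set V)) ∧ r ∉ S ∧ S.card + 1 ≤ T.ncard}
  have hF : F.Nonempty := by
    refine ⟨(T \ {r}).toFinset, ?_, by simp, ?_⟩
    · simpa [Set.insert_eq_of_mem hr] using hT
    · rw [← Set.ncard_eq_toFinset_card', Set.ncard_sdiff_singleton_add_one hr (Set.toFinite T)]
  obtain ⟨Z, ⟨hZ, hrZ, hcard⟩, hmin⟩ :=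
    Set.exists_min_image F (fun S => ∑ x ∈ S, wt x) (Set.toFinite F) hF
  have hpos : ∀ x, 0 < wt x := fun x => by have := hN x; simp only [wt]; omega
  have hlobe : ∀ z ∈ Z, ∃ c K, MinLobe G c K ∧ z ∈ K ∧ r ∉ K ∧ (∀ z' ∈ Z, z' ∈ K → z' = z) ∧
      ∀ x ∈ K, G.dist x r ≤ G.dist z r := by
    intro z hz
    have hnot : ¬ Hub G (insert r ((Z.erase z : Finset V) : Set V)) := by
      intro h
      have h1 := hmin (Z.erase z) ⟨h, fun h => hrZ (Finset.mem_of_mem_erase h), by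
        have := Finset.card_erase_lt_of_mem hz; omega⟩
      have h2 := Finset.sum_erase_add Z wt hz
      have h3 := hpos z
      omega
    let L : Set (Set V) := {K | (∃ c, Lobe G c K) ∧
      ¬ (K ∩ insert r ((Z.erase z : Finset V) : Set V)).Nonempty}
    have hL : L.Nonempty := by
      unfold Hub at hnot
      push Not at hnot
      obtain ⟨c, K, hK, hKe⟩ := hnot
      exact ⟨K, ⟨c, hK⟩, Set.not_nonempty_iff_eq_empty.2 hKe⟩
    obtain ⟨K, ⟨⟨c, hK⟩, hKe⟩, hKmin⟩ := Set.exists_min_image L Set.ncard (Set.toFinite L) hL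
    have hKm : MinLobe G c K := by
      refine ⟨hK, fun c' K' hK' hsub => ?_⟩
      refine Set.eq_of_subset_of_ncard_le hsub (hKmin K' ⟨⟨c', hK'⟩, fun h => hKe ?_⟩)
        (Set.toFinite _)
      exact h.mono (Set.inter_subset_inter_left _ hsub)
    have hrK : r ∉ K := fun h => hKe ⟨r, h, Or.inl rfl⟩
    have huniq : ∀ z' ∈ Z, z' ∈ K → z' = z := by
      intro z' hz' hz'K
      by_contra h
      exact hKe ⟨z', hz'K, Or.inr (by simp [h, hz'])⟩
    have hzK : z ∈ K := by
      obtain ⟨x, hxK, rfl | hx⟩ := hZ c K hK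
      · exact (hrK hxK).elim
      · exact huniq x hx hxK ▸ hxK
    refine ⟨c, K, hKm, hzK, hrK, huniq, fun x hx => ?_⟩
    by_contra hlt
    push Not at hlt
    have hxz : x ≠ z := fun h => by rw [h] at hlt; exact lt_irrefl _ hlt
    have hxZ : x ∉ Z := fun h => hxz (huniq x h hx)
    have hxr : x ≠ r := fun h => hrK (h ▸ hx)
    have hzr : z ≠ r := fun h => hrK (h ▸ hzK)
    have hx' : x ∉ Z.erase z := fun h => hxZ (Finset.mem_of_mem_erase h)
    have hex := hZ.exchange hG hKm (t := z) (t' := x) hx ⟨r, Or.inl rfl, by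
      simp [hxr.symm, hzr.symm]⟩ hzK
    have h1 := hmin (insert x (Z.erase z)) ⟨?_, ?_, ?_⟩
    · rw [Finset.sum_insert hx'] at h1
      have h2 := Finset.sum_erase_add Z wt hz
      have h3 : wt x < wt z := by
        have := hN x; have := hN z; simp only [wt]; omega
      omega
    · convert hex using 1
      ext a
      simp only [Finset.coe_insert, Finset.coe_erase, Set.mem_insert_iff, Set.mem_sdiff,
        Set.mem_singleton_iff, SetLike.mem_coe]
      constructor
      · rintro (h | h | h)
        · exact Or.inr ⟨Or.inl h, h ▸ hzr.symm⟩
        · exact Or.inl h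
        · exact Or.inr ⟨Or.inr h.1, h.2⟩
      · rintro (h | ⟨h | h, h'⟩)
        · exact Or.inr (Or.inl h)
        · exact Or.inl h
        · exact Or.inr (Or.inr ⟨h, h'⟩)
    · simp [hxr.symm, hrZ]
    · rw [Finset.card_insert_of_notMem hx', Finset.card_erase_of_mem hz]
      have := Finset.card_pos.2 ⟨z, hz⟩
      omega
  refine ⟨Z, by simpa using hcard, hZ, ?_, fun z hz => ?_⟩
  · refine ConnSet.of_missing (c := r) (by simpa using hrZ) fun D hD hrD hne hcl => ?_
    obtain ⟨x, hxD, hxmin⟩ := Set.exists_min_image D (fun x => G.dist x r) (Set.toFinite D) hne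
    obtain ⟨y, hxy, hlt⟩ := exists_adj_dist_lt hG (x := x) (r := r) (fun h => hrD (h ▸ hxD))
    by_cases hyZ : y ∈ Z
    · obtain ⟨c, K, hK, hyK, hrK, -, hfar⟩ := hlobe y hyZ
      rcases hK.1.2.2 y hyK x hxy.symm with h | h
      · exact absurd (hfar x h) (by omega)
      · have := hK.1.dist_lt hG hrK _ y hyK rfl
        rw [← h] at this
        omega
    · exact absurd (hxmin y (hcl x hxD y (by simpa using hyZ) hxy)) (by omega)
  · obtain ⟨c, K, hK, hzK, -, huniq, -⟩ := hlobe z hz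
    exact ⟨c, K, hK, hzK, huniq⟩

end Sets

section Colorings

variable {V : Type u} {G : SimpleGraph V} {ι : Type*}

/-- The coloring `φ` has connected color classes, and `τ` picks a token in every color class
such that the tokens form a hub. -/
structure Good (G : SimpleGraph V) (φ : V → ι) (τ : ι → V) : Prop where
  conn : ∀ i, ConnSet G (φ ⁻¹' {i})
  token : ∀ i, φ (τ i) = i
  hub : Hub G (Set.range τ)

theorem Good.injective {φ : V → ι} {τ : ι → V} (h : Good G φ τ) : Function.Injective τ :=
  Function.LeftInverse.injective h.token

/-- One switch, expressed for colorings: `v` takes the color of its neighbor `w`. -/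
def Step (G : SimpleGraph V) (φ ψ : V → ι) : Prop :=
  ∃ v w, G.Adj v w ∧ φ v ≠ φ w ∧ ConnSet G (φ ⁻¹' {φ v} \ {v}) ∧ ψ v = φ w ∧
    ∀ x, x ≠ v → ψ x = φ x

theorem preimage_of_move {φ ψ : V → ι} {v w : V} (hne : φ v ≠ φ w) (hv : ψ v = φ w)
    (hx : ∀ x, x ≠ v → ψ x = φ x) :
    ψ ⁻¹' {φ v} = φ ⁻¹' {φ v} \ {v} ∧ ψ ⁻¹' {φ w} = insert v (φ ⁻¹' {φ w}) ∧
      ∀ i, i ≠ φ v → i ≠ φ w → ψ ⁻¹' {i} = φ ⁻¹' {i} := by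
  refine ⟨Set.ext fun x => ?_, Set.ext fun x => ?_, fun i hi hi' => Set.ext fun x => ?_⟩ <;>
    by_cases hxv : x = v
  · subst hxv; simp [hv, hne.symm]
  · simp [hx x hxv, hxv]
  · subst hxv; simp [hv]
  · simp [hx x hxv, hxv]
  · subst hxv; simp [hv, hi.symm, hi'.symm]
  · simp [hx x hxv]

theorem Step.conn {φ ψ : V → ι} (h : Step G φ ψ) (hφ : ∀ i, ConnSet G (φ ⁻¹' {i})) (i : ι) :
    ConnSet G (ψ ⁻¹' {i}) := by
  obtain ⟨v, w, hvw, hne, hc, hv, hx⟩ := h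
  obtain ⟨h1, h2, h3⟩ := preimage_of_move hne hv hx
  by_cases hi : i = φ v
  · rwa [hi, h1]
  by_cases hi' : i = φ w
  · rw [hi', h2]
    exact (hφ _).insert (w := w) rfl hvw
  · rw [h3 i hi hi']; exact hφ i

/-- `Reach G n φ ψ` means that `ψ` is obtained from `φ` by at most `n` switches passing only
through colorings that admit a hub of tokens. -/
inductive Reach (G : SimpleGraph V) : ℕ → (V → ι) → (V → ι) → Prop
  | refl (n : ℕ) {φ : V → ι} {τ : ι → V} (h : Good G φ τ) : Reach G n φ φ
  | head {n : ℕ} {φ ψ χ : V → ι} {τ : ι → V} (h : Good G φ τ) (hs : Step G φ ψ)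
      (hr : Reach G n ψ χ) : Reach G (n + 1) φ χ

theorem Reach.mono {m n : ℕ} {φ ψ : V → ι} (h : Reach G m φ ψ) (hmn : m ≤ n) :
    Reach G n φ ψ := by
  induction h generalizing n with
  | refl _ h => exact .refl n h
  | head h hs _ ih =>
    obtain ⟨n, rfl⟩ : ∃ n', n = n' + 1 := ⟨n - 1, by omega⟩
    exact .head h hs (ih (by omega))

theorem Reach.trans {m n : ℕ} {φ ψ χ : V → ι} (h : Reach G m φ ψ) (h' : Reach G n ψ χ) :
    Reach G (m + n) φ χ := by
  induction h with
  | refl m h => exact h'.mono (Nat.le_add_left n m)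
  | head h hs _ ih =>
    have := Reach.head h hs (ih h')
    exact this.mono (by omega)

theorem Good.move {φ ψ : V → ι} {τ : ι → V} (h : Good G φ τ) {v w : V} (hvw : G.Adj v w)
    (hne : φ v ≠ φ w) (hc : ConnSet G (φ ⁻¹' {φ v} \ {v})) (hτ : v ≠ τ (φ v))
    (hv : ψ v = φ w) (hx : ∀ x, x ≠ v → ψ x = φ x) : Reach G 1 φ ψ ∧ Good G ψ τ := by
  have hs : Step G φ ψ := ⟨v, w, hvw, hne, hc, hv, hx⟩
  have hψ : Good G ψ τ := by
    refine ⟨hs.conn h.conn, fun i => ?_, h.hub⟩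
    rw [hx _ fun hi => hτ (by rw [← hi, h.token]), h.token]
  exact ⟨.head h hs (.refl 0 hψ), hψ⟩

/-- A branch of a district that contains no token has a vertex that can be switched away. -/
theorem Good.peel [Finite V] {φ : V → ι} {τ : ι → V} (h : Good G φ τ) {a : ι} {y : V}
    {R : Set V} (hya : φ y = a) (hRa : ∀ x ∈ R, φ x = a) (hR : R.Nonempty) (hyR : y ∉ R)
    (hcl : ∀ x ∈ R, ∀ z, φ z = a → G.Adj x z → z ∈ R ∨ z = y) (hτ : τ a ∉ R) :
    ∃ v ∈ R, ∃ w, G.Adj v w ∧ φ w ≠ a ∧ ConnSet G (φ ⁻¹' {a} \ {v}) := by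
  obtain ⟨K, hKR, hKne, ⟨c, -, hcK, hKcl⟩, hrem⟩ :=
    exists_removable_branch (h.conn a) (R := R) (y := y) hRa hR hya hyR hcl
  by_contra hcon
  push Not at hcon
  obtain ⟨x, hxK, i, rfl⟩ := h.hub c K ⟨hKne, hcK, fun x hx z hxz => hKcl x hx z (by
    by_contra hz
    exact hcon x (hKR hx) z hxz hz (hrem x hx)) hxz⟩
  have hi := hRa _ (hKR hxK)
  rw [h.token] at hi
  exact hτ (hi ▸ hKR hxK)

/-- A vertex `y` together with a token-free branch `R` behind it can be moved to a neighboring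
district. -/
theorem Good.move_branch [Finite V] {τ : ι → V} {a : ι} {x y : V} (hyx : G.Adj y x) (m : ℕ) :
    ∀ {φ : V → ι} {R : Set V}, Good G φ τ → R.ncard = m → φ y = a → (∀ z ∈ R, φ z = a) →
    y ∉ R → (∀ p ∈ R, ∀ z, φ z = a → G.Adj p z → z ∈ R ∨ z = y) →
    ConnSet G (φ ⁻¹' {a} \ insert y R) → τ a ∉ insert y R → φ x ≠ a →
    ∀ ψ : V → ι, (∀ z ∈ insert y R, ψ z = φ x) → (∀ z ∉ insert y R, ψ z = φ z) →
    Reach G (2 * m + 1) φ ψ ∧ Good G ψ τ := by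
  classical
  induction m with
  | zero =>
    intro φ R h hm hya hRa hyR hcl hS hτ hxa ψ hψ hψ'
    have hR : R = ∅ := (Set.ncard_eq_zero (Set.toFinite R)).1 hm
    subst hR
    refine h.move hyx (by rw [hya]; exact hxa.symm) (by simpa [hya] using hS)
      (by rw [hya]; exact fun h => hτ (Or.inl h.symm)) (hψ y (Or.inl rfl))
      fun z hz => hψ' z (by simpa using hz)
  | succ m ih =>
    intro φ R h hm hya hRa hyR hcl hS hτ hxa ψ hψ hψ'
    have hR : R.Nonempty := by
      rw [← Set.ncard_pos (Set.toFinite R)]; omega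
    obtain ⟨v, hvR, w, hvw, hwa, hrem⟩ := h.peel hya hRa hR hyR hcl fun h => hτ (Or.inr h)
    have hva := hRa v hvR
    have hyv : y ≠ v := fun h => hyR (h ▸ hvR)
    have hxv : x ≠ v := fun h => hxa (h ▸ hva)
    obtain ⟨h1, hg1⟩ := h.move (ψ := Function.update φ v (φ w)) hvw
      (by rw [hva]; exact hwa.symm) (by rwa [hva])
      (by rw [hva]; exact fun h => hτ (Or.inr (h ▸ hvR))) (by simp)
      (fun x hx => by simp [hx])
    have hfib : Function.update φ v (φ w) ⁻¹' {a} \ insert y (R \ {v}) =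
        φ ⁻¹' {a} \ insert y R := by
      ext z
      by_cases hz : z = v
      · subst hz; simp [hwa, hvR]
      · simp [hz]
    obtain ⟨h2, hg2⟩ := ih (R := R \ {v}) hg1
      (by have := Set.ncard_sdiff_singleton_add_one hvR (Set.toFinite R); omega)
      (by simpa [hyv] using hya) (fun z hz => by simpa [show z ≠ v from hz.2] using hRa z hz.1)
      (fun h => hyR h.1) (fun p hp z hza hpz => by
        have hzv : z ≠ v := by rintro rfl; simp [hwa] at hza
        rw [Function.update_of_ne hzv] at hza
        exact (hcl p hp.1 z hza hpz).imp_left fun h => ⟨h, hzv⟩)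
      (by rwa [hfib]) (fun h => hτ (h.imp_right fun h => h.1)) (by simpa [hxv] using hxa)
      (Function.update ψ v (φ w))
      (fun z hz => by
        have hzv : z ≠ v := by rintro rfl; exact hz.elim (fun h => hyv h.symm) fun h => h.2 rfl
        simpa [hzv, hxv] using hψ z (hz.imp_right fun h => h.1))
      (fun z hz => by
        by_cases hzv : z = v
        · subst hzv; simp
        · have : z ∉ insert y R := fun h => hz (h.imp_right fun h => ⟨h, hzv⟩)
          simpa [hzv] using hψ' z this)
    have h3 := h1.trans h2
    by_cases hwx : φ w = φ x
    · have : Function.update ψ v (φ w) = ψ := by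
        rw [hwx, ← hψ v (Or.inr hvR), Function.update_eq_self]
      rw [this] at h3 hg2
      exact ⟨h3.mono (by omega), hg2⟩
    · obtain ⟨u, ⟨hua, huv⟩, huv'⟩ := (h.conn a).exists_adj hva ⟨y, hya, hyv⟩
      have hu : u ∈ insert y R := (hcl v hvR u hua huv'.symm).symm
      have hψu : Function.update ψ v (φ w) u = φ x := by
        rw [Function.update_of_ne huv]; exact hψ u hu
      have hfib' : Function.update ψ v (φ w) ⁻¹' {φ w} \ {v} = φ ⁻¹' {φ w} := by
        ext z
        by_cases hzv : z = v
        · subst hzv; simp [hva, hwa.symm]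
        · by_cases hz : z ∈ insert y R
          · have hza : φ z = a := hz.elim (fun h => h ▸ hya) (hRa z)
            simp [hzv, hψ z hz, hza, hwa.symm, Ne.symm hwx]
          · simp [hzv, hψ' z hz]
      obtain ⟨h4, hg4⟩ := hg2.move (ψ := ψ) huv'.symm (by rw [hψu]; simpa using hwx)
        (by rw [Function.update_self, hfib']; exact h.conn _)
        (by
          rw [Function.update_self]
          intro hh
          have := h.token (φ w)
          rw [← hh, hva] at this
          exact hwa this.symm)
        (by rw [hψu]; exact hψ v (Or.inr hvR)) (fun z hz => by simp [hz])
      exact ⟨(h3.trans h4).mono (by omega), hg4⟩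

/-- Any vertex other than a token, together with the part of its district that it separates
from the token, can be moved to a neighboring district. -/
theorem Good.push [Finite V] {φ : V → ι} {τ : ι → V} (h : Good G φ τ) {x y : V}
    (hyx : G.Adj y x) (hne : φ x ≠ φ y) (hy : y ≠ τ (φ y)) :
    ∃ Y : Set V, y ∈ Y ∧ (∀ z ∈ Y, φ z = φ y) ∧
      ∀ ψ : V → ι, (∀ z ∈ Y, ψ z = φ x) → (∀ z ∉ Y, ψ z = φ z) →
        Reach G (2 * Y.ncard) φ ψ ∧ Good G ψ τ := by
  obtain ⟨S, hS, hτS, hSc, hScl⟩ := exists_component (G := G) (s := φ ⁻¹' {φ y} \ {y})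
    (z := τ (φ y)) ⟨h.token _, hy.symm⟩
  have hyR : y ∉ (φ ⁻¹' {φ y} \ {y}) \ S := fun h => h.1.2 rfl
  have hfib : φ ⁻¹' {φ y} \ insert y ((φ ⁻¹' {φ y} \ {y}) \ S) = S := by
    ext z
    constructor
    · rintro ⟨h1, h2⟩
      by_contra h3
      exact h2 (Or.inr ⟨⟨h1, fun h => h2 (Or.inl h)⟩, h3⟩)
    · intro hz
      exact ⟨(hS hz).1, fun h => h.elim (hS hz).2 fun h => h.2 hz⟩
  refine ⟨insert y ((φ ⁻¹' {φ y} \ {y}) \ S), Or.inl rfl, ?_, fun ψ hψ hψ' => ?_⟩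
  · rintro z (rfl | hz)
    · rfl
    · exact hz.1.1
  · have key := Good.move_branch hyx _ h rfl rfl (fun z hz => hz.1.1) hyR ?_ (by rwa [hfib])
      (fun h => h.elim (fun h => hy h.symm) fun h => h.2 hτS) hne ψ hψ hψ'
    · refine ⟨key.1.mono ?_, key.2⟩
      rw [Set.ncard_insert_of_notMem hyR (Set.toFinite _)]
      omega
    · rintro p ⟨hp, hpS⟩ z hz hpz
      by_cases hzy : z = y
      · exact Or.inr hzy
      · exact Or.inl ⟨⟨hz, hzy⟩, fun hzS => hpS (hScl z hzS p hp hpz.symm)⟩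

theorem Good.absorb_aux [Finite V] {τ : ι → V} {C : Set V} (hC : ConnSet G C)
    (hi : ∃ i, τ i ∈ C) (n : ℕ) : ∀ φ : V → ι, Good G φ τ → {x | τ (φ x) ∉ C}.ncard = n →
    ∃ ψ, Reach G (2 * n) φ ψ ∧ Good G ψ τ ∧ ∀ x ∈ C, τ (ψ x) ∈ C := by
  classical
  induction n using Nat.strong_induction_on with
  | _ n ih =>
    intro φ h hn
    by_cases hdone : ∀ x ∈ C, τ (φ x) ∈ C
    · exact ⟨φ, .refl _ h, h, hdone⟩
    have hex : ∃ x, x ∈ C ∧ τ (φ x) ∈ C ∧ ∃ y, y ∈ C ∧ τ (φ y) ∉ C ∧ G.Adj y x := by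
      by_contra hcon
      push Not at hcon hdone
      obtain ⟨y, hy, hyC⟩ := hdone
      obtain ⟨i, hi⟩ := hi
      refine hyC (hC.2 {x | x ∈ C ∧ τ (φ x) ∈ C} (fun x hx => hx.1)
        ⟨τ i, hi, by rwa [h.token]⟩ ?_ hy).2
      rintro x ⟨hx, hxC⟩ z hz hxz
      by_contra hcon'
      exact hcon x hx hxC z hz (fun h => hcon' ⟨hz, h⟩) hxz.symm
    obtain ⟨x, hx, hxC, y, hy, hyC, hyx⟩ := hex
    obtain ⟨Y, hyY, hYy, hY⟩ := h.push hyx (fun h => hyC (h ▸ hxC)) (fun h => hyC (h ▸ hy))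
    obtain ⟨h1, hg1⟩ := hY (fun z => if z ∈ Y then φ x else φ z) (fun z hz => by simp [hz])
      (fun z hz => by simp [hz])
    have hYN : Y ⊆ {x | τ (φ x) ∉ C} := fun z hz => by
      change τ (φ z) ∉ C
      rwa [hYy z hz]
    have hset : {z | τ (if z ∈ Y then φ x else φ z) ∉ C} = {x | τ (φ x) ∉ C} \ Y := by
      ext z
      by_cases hz : z ∈ Y <;> simp [hz, hxC]
    have hcard := Set.ncard_sdiff_add_ncard_of_subset hYN (Set.toFinite _)
    have hpos : 0 < Y.ncard := (Set.ncard_pos (Set.toFinite Y)).2 ⟨y, hyY⟩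
    obtain ⟨ψ, h2, hg2, hψ⟩ := ih _ (by rw [hn] at hcard; omega) _ hg1
      (congrArg Set.ncard hset)
    exact ⟨ψ, (h1.trans h2).mono (by omega), hg2, hψ⟩

/-- A connected set `C` containing a token can be cleared of all districts whose token lies
outside `C`. -/
theorem Good.absorb [Finite V] {φ : V → ι} {τ : ι → V} (h : Good G φ τ) {C : Set V}
    (hC : ConnSet G C) (hi : ∃ i, τ i ∈ C) :
    ∃ ψ, Reach G (2 * Nat.card V) φ ψ ∧ Good G ψ τ ∧ ∀ x ∈ C, τ (ψ x) ∈ C := by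
  obtain ⟨ψ, h1, h2⟩ := Good.absorb_aux hC hi _ φ h rfl
  exact ⟨ψ, h1.mono (Nat.mul_le_mul_left 2 (Set.ncard_le_card _)), h2⟩

open Classical in
theorem Good.retoken {φ : V → ι} {τ : ι → V} (h : Good G φ τ) {w : V}
    (hub : Hub G (Set.range (Function.update τ (φ w) w))) :
    Good G φ (Function.update τ (φ w) w) := by
  refine ⟨h.conn, fun i => ?_, hub⟩
  by_cases hi : i = φ w
  · subst hi; simp
  · rw [Function.update_of_ne hi, h.token]

/-- A vertex `z` of a minimal lobe `K` can be made a token, keeping all tokens outside `K`. -/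
theorem Good.install [Finite V] [Nontrivial ι] (hG : G.Connected) {φ : V → ι} {τ : ι → V}
    (h : Good G φ τ) {c z : V} {K : Set V} (hK : MinLobe G c K) (hz : z ∈ K) :
    ∃ ψ τ', Reach G (2 * Nat.card V) φ ψ ∧ Good G ψ τ' ∧ z ∈ Set.range τ' ∧
      ∀ i, τ i ∉ K → τ i ∈ Set.range τ' := by
  classical
  by_cases hzτ : z ∈ Set.range τ
  · exact ⟨φ, τ, .refl _ h, h, hzτ, fun i _ => ⟨i, rfl⟩⟩
  obtain ⟨-, hxK, i, rfl⟩ := h.hub c K hK.1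
  obtain ⟨ψ, h1, hg1, hψ⟩ := h.absorb hK.connSet ⟨i, hxK⟩
  obtain ⟨s, hs⟩ := exists_ne (ψ z)
  have hub := hg1.hub.exchange hG hK (t := τ (ψ z)) (t' := z) hz
    ⟨τ s, ⟨s, rfl⟩, by
      rintro (h' | h')
      · exact hs (hg1.injective h')
      · exact hzτ ⟨s, h'⟩⟩ (hψ z hz)
  refine ⟨ψ, Function.update τ (ψ z) z, h1, hg1.retoken (hub.mono ?_), ⟨ψ z, by simp⟩,
    fun j hj => ?_⟩
  · rintro a (rfl | ⟨⟨j, rfl⟩, hj⟩)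
    · exact ⟨ψ a, by simp⟩
    · have : j ≠ ψ z := fun h => hj (congrArg τ h)
      exact ⟨j, by simp [this]⟩
  · have : j ≠ ψ z := fun h => hj (h ▸ hψ z hz)
    exact ⟨j, by simp [this]⟩

theorem Good.install_separated [Finite V] [Nontrivial ι] (hG : G.Connected) {φ : V → ι}
    {τ : ι → V} (h : Good G φ τ) {Z : Set V}
    (hZ : ∀ z ∈ Z, ∃ c K, MinLobe G c K ∧ z ∈ K ∧ ∀ z' ∈ Z, z' ∈ K → z' = z) :
    ∃ ψ τ', Reach G (2 * Nat.card V * Z.ncard) φ ψ ∧ Good G ψ τ' ∧ Z ⊆ Set.range τ' := by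
  refine Set.Finite.induction_on_subset (motive := fun I _ => ∃ (ψ : V → ι) (τ' : ι → V),
    Reach G (2 * Nat.card V * I.ncard) φ ψ ∧ Good G ψ τ' ∧ I ⊆ Set.range τ') Z (Set.toFinite Z)
    ⟨φ, τ, .refl _ h, h, Set.empty_subset _⟩ ?_
  rintro z I hz hI hzI ⟨ψ, τ', h1, hg1, hIτ⟩
  obtain ⟨c, K, hK, hzK, huniq⟩ := hZ z hz
  obtain ⟨ψ', τ'', h2, hg2, hzτ, hkeep⟩ := hg1.install hG hK hzK
  refine ⟨ψ', τ'', (h1.trans h2).mono ?_, hg2, ?_⟩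
  · rw [Set.ncard_insert_of_notMem hzI (Set.toFinite I), mul_add, mul_one]
  · rintro a (rfl | ha)
    · exact hzτ
    · obtain ⟨i, rfl⟩ := hIτ ha
      exact hkeep i fun hi => hzI (huniq _ (hI ha) hi ▸ ha)

open Classical in
theorem exists_lobe_of_not_hub_update {τ : ι → V} (h : Hub G (Set.range τ)) {j : ι} {w : V}
    (hnot : ¬ Hub G (Set.range (Function.update τ j w))) :
    ∃ c K, Lobe G c K ∧ w ∉ K ∧ τ j ∈ K ∧ ∀ i ≠ j, τ i ∉ K := by
  unfold Hub at hnot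
  push Not at hnot
  obtain ⟨c, K, hK, hKe⟩ := hnot
  have hmiss : ∀ i, Function.update τ j w i ∉ K := fun i hi =>
    (Set.eq_empty_iff_forall_notMem.1 hKe _) ⟨hi, i, rfl⟩
  have hother : ∀ i ≠ j, τ i ∉ K := fun i hij => by simpa [hij] using hmiss i
  refine ⟨c, K, hK, by simpa using hmiss j, ?_, hother⟩
  obtain ⟨-, hi, i, rfl⟩ := h c K hK
  by_contra hj
  exact hother i (fun hij => hj (hij ▸ hi)) hi

/-- A vertex `w` outside the set `Z` of installed tokens can be made a token, keeping `Z`. -/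
theorem Good.extend [Finite V] (hG : G.Connected) {φ : V → ι} {τ : ι → V}
    (h : Good G φ τ) {Z : Set V} {r w : V} (hZτ : Z ⊆ Set.range τ) (hZ : Hub G (insert r Z))
    (hconn : ConnSet G Zᶜ) (hw : w ∉ Z) (hfree : ∀ i, ∃ s ≠ i, τ s ∉ Z) :
    ∃ ψ τ', Reach G (4 * Nat.card V) φ ψ ∧ Good G ψ τ' ∧ insert w Z ⊆ Set.range τ' := by
  classical
  obtain ⟨s₀, -, hs₀⟩ := hfree (φ w)
  obtain ⟨ψ, h1, hg1, hψ⟩ := h.absorb hconn ⟨s₀, hs₀⟩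
  have hkeep : ∀ j, τ j ∉ Z → insert w Z ⊆ Set.range (Function.update τ j w) := by
    rintro j hj a (rfl | ha)
    · exact ⟨j, by simp⟩
    · obtain ⟨i, rfl⟩ := hZτ ha
      have : i ≠ j := fun h => hj (h ▸ ha)
      exact ⟨i, by simp [this]⟩
  have hj := hψ w hw
  by_cases hub : Hub G (Set.range (Function.update τ (ψ w) w))
  · exact ⟨ψ, _, h1.mono (by omega), hg1.retoken hub, hkeep _ hj⟩
  obtain ⟨c, K, hK, hwK, hjK, hother⟩ := exists_lobe_of_not_hub_update hg1.hub hub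
  have hc : ψ c = ψ w := by
    by_contra hc
    refine hwK ((hg1.conn (ψ w)).2 (ψ ⁻¹' {ψ w} ∩ K) Set.inter_subset_left
      ⟨τ (ψ w), hg1.token _, hjK⟩ ?_ (by rfl : w ∈ ψ ⁻¹' {ψ w})).2
    rintro x ⟨-, hxK⟩ y hy hxy
    exact ⟨hy, (hK.2.2 x hxK y hxy).resolve_right fun h => hc (h ▸ hy)⟩
  have hcZ : c ∉ Z := by
    intro hcZ
    obtain ⟨i, rfl⟩ := hZτ hcZ
    rw [hg1.token] at hc
    exact hj (hc ▸ hcZ)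
  obtain ⟨s, hsj, hsZ⟩ := hfree (ψ w)
  obtain ⟨ψ₂, h2, hg2, hψ₂⟩ := hg1.absorb (hconn.diff_lobe hK hcZ) ⟨s, hsZ, hother s hsj⟩
  have hj2 := hψ₂ w ⟨hw, hwK⟩
  have hne : ψ w ≠ ψ₂ w := fun h => hj2.2 (h ▸ hjK)
  refine ⟨ψ₂, _, (h1.trans h2).mono (by omega), hg2.retoken ?_, hkeep _ hj2.1⟩
  by_contra hub2
  obtain ⟨d, L, hL, hwL, hjL, hother2⟩ := exists_lobe_of_not_hub_update hg2.hub hub2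
  refine hZ.not_crossing hG hK hL (Set.disjoint_right.2 fun z hz hzK => ?_)
    (Set.disjoint_right.2 fun z hz hzL => ?_) hwK hwL hjK (hother2 _ hne) hjL hj2.2
  · obtain ⟨i, rfl⟩ := hZτ hz
    exact hother i (fun h => hj (h ▸ hz)) hzK
  · obtain ⟨i, rfl⟩ := hZτ hz
    exact hother2 i (fun h => hj2.1 (h ▸ hz)) hzL

theorem exists_notMem_of_ncard_lt [Finite V] {τ : ι → V} (hτ : Function.Injective τ)
    {I : Set ι} {Z : Set V} (h : Z.ncard < I.ncard) : ∃ s ∈ I, τ s ∉ Z := by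
  by_contra hcon
  push Not at hcon
  have := Set.ncard_le_ncard (Set.image_subset_iff.2 hcon) (Set.toFinite Z)
  rw [Set.ncard_image_of_injective I hτ] at this
  omega

/-- From a hub as in `exists_separated_hub` one obtains a set of all but one of the tokens,
with connected complement, that can be installed starting from any coloring. -/
theorem exists_installable [Finite V] [Finite ι] (hG : G.Connected) {r : V}
    (hcard : Nat.card ι ≤ Nat.card V) (d : ℕ) : ∀ Z : Set V, Z.ncard + 1 + d = Nat.card ι →
    Hub G (insert r Z) → ConnSet G Zᶜ →
    (∀ (φ : V → ι) (τ : ι → V), Good G φ τ → ∃ ψ τ',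
      Reach G (4 * Nat.card V * Z.ncard) φ ψ ∧ Good G ψ τ' ∧ Z ⊆ Set.range τ') →
    ∃ Z' : Set V, Z'.ncard + 1 = Nat.card ι ∧ ConnSet G Z'ᶜ ∧
      ∀ (φ : V → ι) (τ : ι → V), Good G φ τ → ∃ ψ τ',
        Reach G (4 * Nat.card V * Z'.ncard) φ ψ ∧ Good G ψ τ' ∧ Z' ⊆ Set.range τ' := by
  induction d with
  | zero => exact fun Z hZ _ hconn hinst => ⟨Z, hZ, hconn, hinst⟩
  | succ d ih =>
    intro Z hZ hub hconn hinst
    have hcompl := Set.ncard_add_ncard_compl Z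
    obtain ⟨w, hw, hwc⟩ := hconn.exists_removable (by omega)
    have hins : (insert w Z).ncard = Z.ncard + 1 :=
      Set.ncard_insert_of_notMem hw (Set.toFinite Z)
    refine ih (insert w Z) (by omega) (hub.mono (Set.insert_subset_insert (Set.subset_insert _ _)))
      ?_ fun φ τ h => ?_
    · have : (insert w Z)ᶜ = Zᶜ \ {w} := by
        ext x
        simp [not_or, and_comm]
      rwa [this]
    · obtain ⟨ψ, τ', h1, hg1, hZτ⟩ := hinst φ τ h
      obtain ⟨χ, τ'', h2, hg2, hwτ⟩ := hg1.extend hG hZτ hub hconn hw fun i => by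
        refine exists_notMem_of_ncard_lt hg1.injective (I := {i}ᶜ) ?_
        have := Set.ncard_add_ncard_compl ({i} : Set ι)
        rw [Set.ncard_singleton] at this
        omega
      refine ⟨χ, τ'', (h1.trans h2).mono ?_, hg2, hwτ⟩
      rw [hins, mul_add, mul_one]

/-- All good colorings can be brought, in `O(kn)` switches, to one and the same partition. -/
theorem exists_canonical_partition [Finite V] [Finite ι] [Nontrivial ι] (hG : G.Connected)
    {φ₀ : V → ι} {τ₀ : ι → V} (h₀ : Good G φ₀ τ₀) :
    ∃ Z : Set V, ∀ (φ : V → ι) (τ : ι → V), Good G φ τ → ∃ ψ τ',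
      Reach G (4 * Nat.card ι * Nat.card V) φ ψ ∧ Good G ψ τ' ∧
      ∀ x y, ψ x = ψ y ↔ x = y ∨ (x ∉ Z ∧ y ∉ Z) := by
  have hT : (Set.range τ₀).ncard = Nat.card ι := by
    rw [← Set.image_univ, Set.ncard_image_of_injective _ h₀.injective, Set.ncard_univ]
  obtain ⟨i₀⟩ : Nonempty ι := inferInstance
  obtain ⟨Z₀, hZ₀, hub, hconn, hsep⟩ := exists_separated_hub hG h₀.hub (r := τ₀ i₀) ⟨i₀, rfl⟩
  obtain ⟨Z, hZ, hZc, hinst⟩ := exists_installable hG (Nat.card_le_card_of_injective _ h₀.injective)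
    (Nat.card ι - (Z₀.ncard + 1)) Z₀ (by omega) hub hconn fun φ τ h => by
      obtain ⟨ψ, τ', h1, h2⟩ := h.install_separated hG hsep
      exact ⟨ψ, τ', h1.mono (by gcongr; omega), h2⟩
  refine ⟨Z, fun φ τ h => ?_⟩
  obtain ⟨ψ, τ', h1, hg1, hZτ⟩ := hinst φ τ h
  obtain ⟨s, -, hs⟩ := exists_notMem_of_ncard_lt hg1.injective (I := Set.univ) (Z := Z)
    (by rw [Set.ncard_univ]; omega)
  have huniq : ∀ i, τ' i ∉ Z → i = s := by
    intro i hi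
    by_contra his
    have hsub : insert (τ' i) (insert (τ' s) Z) ⊆ Set.range τ' := by
      rintro a (rfl | rfl | ha)
      exacts [⟨i, rfl⟩, ⟨s, rfl⟩, hZτ ha]
    have hle := Set.ncard_le_ncard hsub (Set.toFinite _)
    rw [← Set.image_univ, Set.ncard_image_of_injective _ hg1.injective, Set.ncard_univ,
      Set.ncard_insert_of_notMem, Set.ncard_insert_of_notMem hs] at hle
    · omega
    · rintro (h | h)
      exacts [his (hg1.injective h), hi h]
  obtain ⟨χ, h2, hg2, hχ⟩ := hg1.absorb hZc ⟨s, hs⟩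
  have hin : ∀ x ∈ Z, τ' (χ x) = x := by
    intro x hx
    obtain ⟨i, rfl⟩ := hZτ hx
    rw [hg2.token]
  have hout : ∀ x ∉ Z, χ x = s := fun x hx => huniq _ (hχ x hx)
  refine ⟨χ, τ', (h1.trans h2).mono ?_, hg2, fun x y => ⟨fun hxy => ?_, ?_⟩⟩
  · rw [← hZ]; ring_nf; omega
  · by_cases hx : x ∈ Z
    · have hx' := hin x hx
      by_cases hy : y ∈ Z
      · exact Or.inl (by rw [← hx', hxy, hin y hy])
      · rw [hxy, hout y hy] at hx'
        exact absurd (hx' ▸ hx) hs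
    · by_cases hy : y ∈ Z
      · have hy' := hin y hy
        rw [← hxy, hout x hx] at hy'
        exact absurd (hy' ▸ hy) hs
      · exact Or.inr ⟨hx, hy⟩
  · rintro (rfl | ⟨hx, hy⟩)
    · rfl
    · rw [hout x hx, hout y hy]

end Colorings

section DistrictMaps

variable {V : Type u} {G : SimpleGraph V} {k : ℕ}

theorem eq_of_parts_eq {P Q : DistrictMap G k} (h : P.parts = Q.parts) : P = Q := by
  cases P
  cases Q
  cases h
  rfl

theorem preimage_singleton_injective {ι : Type*} {φ : V → ι} (h : ∀ i, ConnSet G (φ ⁻¹' {i})) :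
    Function.Injective fun i => φ ⁻¹' {i} := by
  intro i j hij
  obtain ⟨x, hx⟩ := (h i).1
  have hx' : x ∈ φ ⁻¹' {j} := hij.subset hx
  exact (show φ x = i from hx).symm.trans hx'

/-- The district map whose districts are the color classes of a coloring. -/
def toMap (φ : V → Fin k) (h : ∀ i, ConnSet G (φ ⁻¹' {i})) : DistrictMap G k where
  parts := Set.range fun i => φ ⁻¹' {i}
  ncard_parts := by
    rw [← Set.image_univ, Set.ncard_image_of_injective _ (preimage_singleton_injective h),
      Set.ncard_univ, Nat.card_fin]
  nonempty_mem := by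
    rintro _ ⟨i, rfl⟩
    exact (h i).1
  pairwise_disjoint := by
    rintro _ ⟨i, rfl⟩ _ ⟨j, rfl⟩ hij
    refine Set.disjoint_left.2 fun x hx hx' => hij ?_
    rw [show i = j from (show φ x = i from hx).symm.trans hx']
  covers := fun v => ⟨_, ⟨φ v, rfl⟩, rfl⟩
  connected_mem := by
    rintro _ ⟨i, rfl⟩
    exact connSet_iff_connected.1 (h i)

theorem eq_of_mem_parts {P : DistrictMap G k} {s t : Set V} (hs : s ∈ P.parts) (ht : t ∈ P.parts)
    {x : V} (hxs : x ∈ s) (hxt : x ∈ t) : s = t := by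
  by_contra h
  exact Set.disjoint_left.1 (P.pairwise_disjoint hs ht h) hxs hxt

theorem exists_eq_toMap [Finite V] (P : DistrictMap G k) : ∃ φ h, P = toMap φ h := by
  choose p hp hmem using P.covers
  let e : P.parts ≃ Fin k :=
    Finite.equivFinOfCardEq ((Nat.card_coe_set_eq _).trans P.ncard_parts)
  have hfib : ∀ i, (fun v => e ⟨p v, hp v⟩) ⁻¹' {i} = (e.symm i : Set V) := by
    intro i
    ext x
    rw [Set.mem_preimage, Set.mem_singleton_iff, ← Equiv.eq_symm_apply, Subtype.ext_iff]
    exact ⟨fun h => h ▸ hmem x, fun h => eq_of_mem_parts (hp x) (e.symm i).2 (hmem x) h⟩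
  refine ⟨fun v => e ⟨p v, hp v⟩, fun i => ?_, eq_of_parts_eq (Set.ext fun s => ?_)⟩
  · rw [hfib]
    exact connSet_iff_connected.2 (P.connected_mem _ (e.symm i).2)
  · constructor
    · intro hs
      exact ⟨e ⟨s, hs⟩, by simp only [hfib, Equiv.symm_apply_apply]⟩
    · rintro ⟨i, rfl⟩
      simp only [hfib]
      exact (e.symm i).2

theorem switchOut_of_move {φ ψ : V → Fin k} (hφ : ∀ i, ConnSet G (φ ⁻¹' {i}))
    (hψ : ∀ i, ConnSet G (ψ ⁻¹' {i})) {v w : V} (hvw : G.Adj v w) (hne : φ v ≠ φ w)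
    (hc : ConnSet G (φ ⁻¹' {φ v} \ {v})) (hv : ψ v = φ w) (hx : ∀ x, x ≠ v → ψ x = φ x) :
    SwitchOut (toMap φ hφ) (toMap ψ hψ) (φ ⁻¹' {φ v}) (φ ⁻¹' {φ v} \ {v}) := by
  obtain ⟨u, hu, huv⟩ := (hφ (φ v)).exists_adj (v := v) rfl hc.1
  have hinj := preimage_singleton_injective hφ
  refine ⟨u, v, w, φ ⁻¹' {φ w}, huv, hvw, ⟨φ v, rfl⟩, ⟨φ w, rfl⟩, hu.1, rfl, rfl,
    fun h => hne (hinj h), rfl, hc.1, connSet_iff_connected.1 hc, ?_⟩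
  obtain ⟨h1, h2, h3⟩ := preimage_of_move hne hv hx
  ext s
  constructor
  · rintro ⟨i, rfl⟩
    by_cases hi : i = φ v
    · exact Or.inr (Or.inl (by simp only [hi, h1]))
    by_cases hi' : i = φ w
    · exact Or.inr (Or.inr (by simp only [hi', h2, Set.mem_singleton_iff]))
    · refine Or.inl ⟨⟨i, (h3 i hi hi').symm⟩, ?_⟩
      simp only [h3 i hi hi']
      rintro (h | h)
      exacts [hi (hinj h), hi' (hinj h)]
  · rintro (⟨⟨i, rfl⟩, hs⟩ | rfl | rfl)
    · exact ⟨i, h3 i (fun h => hs (Or.inl (by simp only [h])))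
        (fun h => hs (Or.inr (by simp only [h, Set.mem_singleton_iff])))⟩
    · exact ⟨φ v, h1⟩
    · exact ⟨φ w, h2⟩

theorem Step.switch {φ ψ : V → Fin k} (h : Step G φ ψ) (hφ : ∀ i, ConnSet G (φ ⁻¹' {i}))
    (hψ : ∀ i, ConnSet G (ψ ⁻¹' {i})) : Switch (toMap φ hφ) (toMap ψ hψ) := by
  obtain ⟨v, w, hvw, hne, hc, hv, hx⟩ := h
  obtain ⟨u, v', w', sw, h1, h2, h3, h4, h5, h6, h7, h8, h9, h10, h11, h12⟩ :=
    switchOut_of_move hφ hψ hvw hne hc hv hx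
  rw [h9] at h10 h11 h12
  exact ⟨u, v', w', _, sw, h1, h2, h3, h4, h5, h6, h7, h8, h10, h11, h12⟩

theorem Good.exists_contraction [Finite V] {τ : Fin k → V} (i : Fin k) (m : ℕ) :
    ∀ {φ : V → Fin k} (h : Good G φ τ), (φ ⁻¹' {i}).ncard = m + 1 →
    ∃ (f : ℕ → DistrictMap G k) (g : ℕ → Set V), f 0 = toMap φ h.conn ∧ g 0 = φ ⁻¹' {i} ∧
      g m = {τ i} ∧ ∀ j < m, SwitchOut (f j) (f (j + 1)) (g j) (g (j + 1)) := by
  classical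
  induction m with
  | zero =>
    intro φ h hcard
    obtain ⟨x, hx⟩ := Set.ncard_eq_one.1 hcard
    have hτ : τ i ∈ φ ⁻¹' {i} := h.token i
    rw [hx] at hτ
    refine ⟨fun _ => toMap φ h.conn, fun _ => φ ⁻¹' {i}, rfl, rfl, ?_, fun j hj => by omega⟩
    rw [hx, show τ i = x from hτ]
  | succ m ih =>
    intro φ h hcard
    have hτ : τ i ∈ φ ⁻¹' {i} := h.token i
    have hcard' := Set.ncard_sdiff_singleton_add_one hτ (Set.toFinite _)
    obtain ⟨v, ⟨hv, hvτ⟩, w, hvw, hwi, hc⟩ := h.peel (y := τ i) (R := φ ⁻¹' {i} \ {τ i})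
      (h.token i) (fun x hx => hx.1) ((Set.ncard_pos (Set.toFinite _)).1 (by omega))
      (fun h => h.2 rfl) (fun x _ z hz _ => by
        by_cases hzτ : z = τ i
        · exact Or.inr hzτ
        · exact Or.inl ⟨hz, hzτ⟩) (fun h => h.2 rfl)
    obtain rfl : φ v = i := hv
    have hself : Function.update φ v (φ w) v = φ w := Function.update_self v _ φ
    have hother : ∀ x, x ≠ v → Function.update φ v (φ w) x = φ x := fun x hx =>
      Function.update_of_ne hx _ φ
    have hgood := (h.move hvw hwi.symm hc hvτ hself hother).2
    have hfib := (preimage_of_move hwi.symm hself hother).1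
    have hcard'' := Set.ncard_sdiff_singleton_add_one (show v ∈ φ ⁻¹' {φ v} from rfl)
      (Set.toFinite _)
    obtain ⟨f, g, hf, hg, hgm, hfg⟩ := ih hgood (by rw [hfib]; omega)
    refine ⟨fun n => n.casesOn (toMap φ h.conn) f, fun n => n.casesOn (φ ⁻¹' {φ v}) g, rfl, rfl,
      hgm, fun j hj => ?_⟩
    cases j with
    | zero =>
      change SwitchOut (toMap φ h.conn) (f 0) (φ ⁻¹' {φ v}) (g 0)
      rw [hf, hg, hfib]
      exact switchOut_of_move h.conn hgood.conn hvw hwi.symm hc hself hother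
    | succ j => exact hfg j (by omega)

theorem Good.contractibleMap [Finite V] {φ : V → Fin k} {τ : Fin k → V} (h : Good G φ τ) :
    ContractibleMap (toMap φ h.conn) := by
  rintro _ ⟨i, rfl⟩
  have hpos : 0 < (φ ⁻¹' {i}).ncard := (Set.ncard_pos (Set.toFinite _)).2 (h.conn i).1
  exact ⟨τ i, ⟨i, rfl⟩, Good.exists_contraction i _ h (Nat.sub_add_cancel hpos).symm⟩

/-- `Shrinks G t s` means that the connected set `s` can be reduced to `{t}` by successively
removing vertices that have a neighbor outside. -/
inductive Shrinks (G : SimpleGraph V) (t : V) : Set V → Prop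
  | singleton : Shrinks G t {t}
  | step {s : Set V} {v w : V} (hs : ConnSet G s) (hw : w ∉ s) (hvw : G.Adj v w)
      (h : Shrinks G t (s \ {v})) : Shrinks G t s

theorem Shrinks.mem {t : V} {s : Set V} (h : Shrinks G t s) : t ∈ s := by
  induction h with
  | singleton => rfl
  | step _ _ _ _ ih => exact ih.1

theorem Shrinks.mem_lobe {t c : V} {s K : Set V} (h : Shrinks G t s) (hK : Lobe G c K)
    (hKs : K ⊆ s) : t ∈ K := by
  induction h with
  | singleton =>
    obtain ⟨x, hx⟩ := hK.1
    exact (show x = t from hKs hx) ▸ hx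
  | @step s v w hs hw hvw h ih =>
    by_cases hv : v ∈ K
    · have hc : c ∉ s := by
        rcases hK.2.2 v hv w hvw with h | h
        exacts [absurd (hKs h) hw, h ▸ hw]
      exact hs.2 K hKs hK.1 (fun x hx y hy hxy =>
        (hK.2.2 x hx y hxy).resolve_right fun h => hc (h ▸ hy)) h.mem.1
    · exact ih fun x hx => ⟨hKs hx, fun hxv => hv (hxv ▸ hx)⟩

theorem shrinks_of_switchOut {t : V} (m : ℕ) : ∀ {f : ℕ → DistrictMap G k} {g : ℕ → Set V},
    g m = {t} → (∀ j < m, SwitchOut (f j) (f (j + 1)) (g j) (g (j + 1))) →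
    Shrinks G t (g 0) := by
  induction m with
  | zero =>
    intro f g hg _
    rw [hg]
    exact .singleton
  | succ m ih =>
    intro f g hg hfg
    have h := ih (f := fun n => f (n + 1)) (g := fun n => g (n + 1)) hg
      fun j hj => hfg (j + 1) (by omega)
    obtain ⟨u, v, w, sw, -, hvw, hs, hsw, -, -, hw, hne, hg1, -⟩ := hfg 0 (by omega)
    refine .step (connSet_iff_connected.2 ((f 0).connected_mem _ hs))
      (fun hws => hne (eq_of_mem_parts hs hsw hws hw)) hvw ?_
    rw [← hg1]
    exact h

theorem exists_good_of_contractibleMap {φ : V → Fin k} {h : ∀ i, ConnSet G (φ ⁻¹' {i})}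
    (hφ : ContractibleMap (toMap φ h)) : ∃ τ, Good G φ τ := by
  have hex : ∀ i, ∃ t, Shrinks G t (φ ⁻¹' {i}) := by
    intro i
    obtain ⟨t, -, f, g, -, hg, hgt, hfg⟩ := hφ _ ⟨i, rfl⟩
    refine ⟨t, ?_⟩
    have := shrinks_of_switchOut _ hgt hfg
    rwa [hg] at this
  choose τ hτ using hex
  refine ⟨τ, h, fun i => (hτ i).mem, fun c K hK => ?_⟩
  by_cases hKc : K ⊆ φ ⁻¹' {φ c}
  · exact ⟨_, (hτ _).mem_lobe hK hKc, φ c, rfl⟩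
  · obtain ⟨x, hx, hxc⟩ := Set.not_subset.1 hKc
    refine ⟨τ (φ x), ?_, φ x, rfl⟩
    refine ((h (φ x)).2 (φ ⁻¹' {φ x} ∩ K) Set.inter_subset_left ⟨x, rfl, hx⟩ ?_ (hτ _).mem).2
    rintro y ⟨-, hyK⟩ z hz hyz
    exact ⟨hz, (hK.2.2 y hyK z hyz).resolve_right fun h => hxc (h ▸ hz).symm⟩

/-- `P` and `Q` are joined by at most `n` switches through contractible district maps. -/
def Linked (n : ℕ) (P Q : DistrictMap G k) : Prop :=
  ∃ (m : ℕ) (f : ℕ → DistrictMap G k), m ≤ n ∧ f 0 = P ∧ f m = Q ∧ SwitchChain f m ∧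
    ∀ i ≤ m, ContractibleMap (f i)

theorem Linked.refl (n : ℕ) {P : DistrictMap G k} (h : ContractibleMap P) : Linked n P P :=
  ⟨0, fun _ => P, Nat.zero_le n, rfl, rfl, fun _ hi => absurd hi (Nat.not_lt_zero _),
    fun _ _ => h⟩

theorem Linked.head {n : ℕ} {P Q R : DistrictMap G k} (hP : ContractibleMap P)
    (hPQ : SwitchAdj P Q) (h : Linked n Q R) : Linked (n + 1) P R := by
  obtain ⟨m, f, hm, hf0, hfm, hf, hc⟩ := h
  refine ⟨m + 1, fun i => i.casesOn P f, by omega, rfl, hfm, fun i hi => ?_, fun i hi => ?_⟩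
  · cases i with
    | zero =>
      change SwitchAdj P (f 0)
      rwa [hf0]
    | succ i => exact hf i (by omega)
  · cases i with
    | zero => exact hP
    | succ i => exact hc i (by omega)

theorem Linked.symm {n : ℕ} {P Q : DistrictMap G k} (h : Linked n P Q) : Linked n Q P := by
  obtain ⟨m, f, hm, hf0, hfm, hf, hc⟩ := h
  refine ⟨m, fun i => f (m - i), hm, by simpa using hfm, by simpa using hf0, fun i hi => ?_,
    fun i _ => hc _ (Nat.sub_le m i)⟩
  have := hf (m - (i + 1)) (by omega)
  rw [show m - (i + 1) + 1 = m - i by omega] at this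
  exact this.symm

theorem Linked.trans {l n : ℕ} {P Q R : DistrictMap G k} (h : Linked l P Q)
    (h' : Linked n Q R) : Linked (l + n) P R := by
  obtain ⟨m, f, hm, rfl, rfl, hf, hc⟩ := h
  induction m generalizing l f with
  | zero =>
    obtain ⟨m', g, hm', h⟩ := h'
    exact ⟨m', g, by omega, h⟩
  | succ m ih =>
    have := ih (l := m) (fun i => f (i + 1)) le_rfl h'
      (fun i hi => hf (i + 1) (by omega)) fun i hi => hc (i + 1) (by omega)
    obtain ⟨m', g, hm', h⟩ := Linked.head (hc 0 (by omega)) (hf 0 (by omega)) this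
    exact ⟨m', g, by omega, h⟩

theorem Reach.linked [Finite V] {n : ℕ} {φ ψ : V → Fin k} (h : Reach G n φ ψ) :
    ∀ (hφ : ∀ i, ConnSet G (φ ⁻¹' {i})) (hψ : ∀ i, ConnSet G (ψ ⁻¹' {i})),
    Linked n (toMap φ hφ) (toMap ψ hψ) := by
  induction h with
  | refl n h => exact fun _ _ => .refl n h.contractibleMap
  | head h hs _ ih =>
    intro hφ hψ
    exact .head h.contractibleMap (Or.inl (hs.switch hφ (hs.conn hφ))) (ih (hs.conn hφ) hψ)

theorem toMap_eq_toMap {φ ψ : V → Fin k} (hφ : ∀ i, ConnSet G (φ ⁻¹' {i}))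
    (hψ : ∀ i, ConnSet G (ψ ⁻¹' {i})) (h : ∀ x y, φ x = φ y ↔ ψ x = ψ y) :
    toMap φ hφ = toMap ψ hψ := by
  refine eq_of_parts_eq (Set.ext fun s => ⟨?_, ?_⟩)
  · rintro ⟨i, rfl⟩
    obtain ⟨x, rfl⟩ := (hφ i).1
    exact ⟨ψ x, Set.ext fun y => (h y x).symm⟩
  · rintro ⟨i, rfl⟩
    obtain ⟨x, rfl⟩ := (hψ i).1
    exact ⟨φ x, Set.ext fun y => h y x⟩

theorem parts_eq_of_one (P : DistrictMap G 1) : P.parts = {Set.univ} := by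
  obtain ⟨s, hs⟩ := Set.ncard_eq_one.1 P.ncard_parts
  rw [hs, Set.singleton_eq_singleton_iff]
  refine Set.eq_univ_of_forall fun v => ?_
  obtain ⟨t, ht, hvt⟩ := P.covers v
  rw [hs] at ht
  exact (show t = s from ht) ▸ hvt

theorem linked_of_contractibleMap [Finite V] (hG : G.Connected) (hk : 1 ≤ k)
    {P Q : DistrictMap G k} (hP : ContractibleMap P) (hQ : ContractibleMap Q) :
    Linked (8 * k * Nat.card V) P Q := by
  rcases hk.eq_or_lt with rfl | hk
  · rw [eq_of_parts_eq ((parts_eq_of_one P).trans (parts_eq_of_one Q).symm)]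
    exact .refl _ hQ
  have : Nontrivial (Fin k) := Fin.nontrivial_iff_two_le.2 hk
  obtain ⟨φ, hφ, rfl⟩ := exists_eq_toMap P
  obtain ⟨χ, hχ, rfl⟩ := exists_eq_toMap Q
  obtain ⟨τ, hgφ⟩ := exists_good_of_contractibleMap hP
  obtain ⟨σ, hgχ⟩ := exists_good_of_contractibleMap hQ
  obtain ⟨Z, hZ⟩ := exists_canonical_partition hG hgχ
  obtain ⟨φ', τ', h1, hg1, hker1⟩ := hZ φ τ hgφ
  obtain ⟨χ', σ', h2, hg2, hker2⟩ := hZ χ σ hgχ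
  rw [Nat.card_fin] at h1 h2
  have key := h1.linked hφ hg1.conn
  rw [toMap_eq_toMap hg1.conn hg2.conn fun x y => (hker1 x y).trans (hker2 x y).symm] at key
  have := key.trans (h2.linked hχ hg2.conn).symm
  rwa [show 4 * k * Nat.card V + 4 * k * Nat.card V = 8 * k * Nat.card V by ring] at this

end DistrictMaps

end DistrictSwitch

/-- There is an absolute constant `C > 0` such that for every connected
graph `G` on `n` vertices and every `1 ≤ k ≤ n`, the switch graph `Γ_k'(G)` over
contractible `k`-district maps is connected with diameter at most `C·k·n`. -/
theorem contractible_switchGraph_connected_diameter :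
    ∃ C : ℕ, 0 < C ∧
      ∀ (V : Type) [Fintype V], ∀ (G : SimpleGraph V), G.Connected →
        ∀ k : ℕ, 1 ≤ k → k ≤ Nat.card V →
          ∀ P Q : DistrictMap G k, ContractibleMap P → ContractibleMap Q →
            ∃ (m : ℕ) (f : ℕ → DistrictMap G k),
              m ≤ C * k * Nat.card V ∧ f 0 = P ∧ f m = Q ∧ SwitchChain f m ∧
              ∀ i ≤ m, ContractibleMap (f i) := by
  refine ⟨8, by norm_num, fun V _ G hG k hk _ P Q hP hQ => ?_⟩
  exact DistrictSwitch.linked_of_contractibleMap hG hk hP hQ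
end
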